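/- arXiv:1301.2446 — 2 statements merged into one kernel-verified Lean document; each statement's English description precedes it below -/
import Mathlib

section
/- Let L be a finite-dimensional (right) H-comodule Lie algebra over a field F of characteristic 0, where H is an involutory Hopf algebra (S ∘ S = id_H). Then the solvable radical R of L (the largest solvable ideal of L, equivalently the supremum of all solvable Lie ideals of L) is an H-subcomodule: ρ(R) is contained in the canonical image of R ⊗_F H in L ⊗_F H. -/
open TensorProduct

variable {F : Type*} [Field F] {L H : Type*}

/-- A submodule `V` of a (right) `H`-comodule `L` with structure map `ρ` is an `H`-subcomodule
if `ρ(V)` is contained in the canonical image of `V ⊗[F] H` in `L ⊗[F] H`. -/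
def IsSubcomodule [Field F] [AddCommGroup L] [Module F L] [AddCommGroup H] [Module F H]
    (ρ : L →ₗ[F] L ⊗[F] H) (V : Submodule F L) : Prop :=
  ∀ v ∈ V, ρ v ∈ LinearMap.range (LinearMap.rTensor H V.subtype)

/-- The unique bilinear map `β : (L ⊗ H) × (L ⊗ H) → L ⊗ H` with
`β (x ⊗ h) (y ⊗ q) = ⁅x, y⁆ ⊗ (h * q)`. -/
noncomputable def tensorLieMul [Field F] [LieRing L] [LieAlgebra F L] [Ring H] [Algebra F H] :
    (L ⊗[F] H) →ₗ[F] (L ⊗[F] H) →ₗ[F] (L ⊗[F] H) :=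
  TensorProduct.map₂
    (LinearMap.mk₂ F (fun x y : L => ⁅x, y⁆) add_lie smul_lie lie_add lie_smul)
    (LinearMap.mul F H)

section Radical

open Module LieModule

open Polynomial in
/-- **Jacobson's lemma**: a commutator that commutes with one of its entries is nilpotent. -/
theorem isNilpotent_lie_of_commute {K V : Type*} [Field K] [CharZero K] [AddCommGroup V]
    [Module K V] [FiniteDimensional K V] {a b : End K V} (h : Commute ⁅a, b⁆ b) :
    IsNilpotent ⁅a, b⁆ := by
  set c := ⁅a, b⁆ with hc
  have hmin : minpoly K c ≠ 0 := minpoly.ne_zero (Algebra.IsIntegral.isIntegral c)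
  obtain ⟨p, hp, hXp⟩ := (minpoly K c).exists_eq_pow_rootMultiplicity_mul_and_not_dvd hmin 0
  set k := (minpoly K c).rootMultiplicity 0
  rw [C_0, sub_zero] at hp hXp
  have hcop : IsCoprime (X ^ (k + 1)) p :=
    ((irreducible_X.coprime_iff_not_dvd).2 hXp).pow_left
  obtain ⟨u, v, huv⟩ := hcop
  have hcp : c ^ k * aeval c p = 0 := by
    rw [← aeval_X (R := K) c, ← map_pow, aeval_X, ← map_mul, ← hp, minpoly.aeval]
  have huv' : aeval c (u * X ^ (k + 1)) + aeval c (v * p) = 1 := by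
    rw [← map_add, huv, map_one]
  have hkill : aeval c (X ^ k * (v * p)) = 0 := by
    rw [show X ^ k * (v * p) = v * (X ^ k * p) by ring, map_mul, map_mul, map_pow, aeval_X, hcp,
      mul_zero]
  set e := aeval c (u * X ^ (k + 1)) with he
  have hidem : IsIdempotentElem e := by
    have h0 : e * aeval c (v * p) = 0 := by
      rw [he, ← map_mul, show u * X ^ (k + 1) * (v * p) = (u * X) * (X ^ k * (v * p)) by ring,
        map_mul, hkill, mul_zero]
    calc e * e = e * (e + aeval c (v * p)) := by rw [mul_add, h0, add_zero]
      _ = e := by rw [huv', mul_one]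
  have htrace : LinearMap.trace K V e = 0 := by
    have hcomm : Commute (aeval c (u * X ^ k)) b := by
      refine Polynomial.induction_on (motive := fun q ↦ Commute (aeval c q) b) _ ?_ ?_ ?_
      · intro r; simpa using Algebra.commute_algebraMap_left r b
      · intro q r hq hr; simpa using hq.add_left hr
      · intro n r _
        simpa using Commute.mul_left (Algebra.commute_algebraMap_left r b) (h.pow_left (n + 1))
    have : e = aeval c (u * X ^ k) * a * b - b * (aeval c (u * X ^ k) * a) := by
      rw [he, pow_succ, ← mul_assoc, map_mul, aeval_X, ← mul_assoc, ← hcomm.eq, mul_assoc,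
        mul_assoc, ← mul_sub, hc, Ring.lie_def]
    rw [this, map_sub, LinearMap.trace_mul_comm, sub_self]
  have he0 : e = 0 := LinearMap.IsIdempotentElem.eq_zero_of_trace_eq_zero hidem htrace
  refine ⟨k, ?_⟩
  have h1 : aeval c (v * p) = 1 := by rw [← huv', he0, zero_add]
  rw [← mul_one (c ^ k), ← h1, ← hkill, map_mul _ (X ^ k), map_pow, aeval_X]

theorem isIrreducible_of_isAtom {K 𝔤 V : Type*} [Field K] [LieRing 𝔤] [AddCommGroup V]
    [Module K V] [LieRingModule 𝔤 V] {W : LieSubmodule K 𝔤 V} (hW : IsAtom W) :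
    IsIrreducible K 𝔤 W := by
  have : Nontrivial W := (LieSubmodule.nontrivial_iff_ne_bot K 𝔤 V).2 hW.1
  refine IsIrreducible.mk fun N hN ↦ ?_
  have hle : N.map W.incl ≤ W := by
    rintro _ ⟨w, -, rfl⟩; exact w.2
  have hne : N.map W.incl ≠ ⊥ := by
    contrapose! hN
    rw [LieSubmodule.eq_bot_iff] at hN ⊢
    intro w hw
    exact Subtype.ext (hN w ⟨w, hw, rfl⟩)
  have heq := (hW.le_iff.1 hle).resolve_left hne
  rw [eq_top_iff]
  intro w _
  obtain ⟨w', hw', h⟩ := heq.ge w.2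
  rwa [← Subtype.ext (a1 := w') (a2 := w) h]

variable {K 𝔤 V : Type*} [Field K] [LieRing 𝔤] [LieAlgebra K 𝔤] [AddCommGroup V]
  [Module K V] [LieRingModule 𝔤 V] [LieModule K 𝔤 V]

theorem commute_toEnd_of_lie_lie_eq_zero {x y : 𝔤} (h : ∀ v : V, ⁅⁅x, y⁆, v⁆ = 0) :
    Commute (toEnd K 𝔤 V x) (toEnd K 𝔤 V y) :=
  LinearMap.ext fun v ↦ by
    have hv := h v
    rw [lie_lie, sub_eq_zero] at hv
    exact hv

variable [FiniteDimensional K V]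

/-- Over an irreducible module, an ideal acting by nilpotent endomorphisms acts trivially. -/
theorem lie_eq_zero_of_isIrreducible_of_isNilpotent [IsIrreducible K 𝔤 V] (N : LieIdeal K 𝔤)
    (hN : ∀ x ∈ N, IsNilpotent (toEnd K 𝔤 V x)) {x : 𝔤} (hx : x ∈ N) (v : V) : ⁅x, v⁆ = 0 := by
  have : Nontrivial V := nontrivial_of_isIrreducible K 𝔤 V
  have : LieModule.IsNilpotent N V :=
    (LieModule.isNilpotent_iff_forall' (R := K)).2 fun x ↦ hN x x.2
  let W : LieSubmodule K 𝔤 V :=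
    { (maxTrivSubmodule K N V).toSubmodule with
      lie_mem := by
        intro y w hw n
        have hw' : ∀ z ∈ N, ⁅z, w⁆ = 0 := fun z hz ↦ hw ⟨z, hz⟩
        change ⁅(n : 𝔤), ⁅y, w⁆⁆ = 0
        rw [leibniz_lie, hw' n n.2, lie_zero, add_zero, hw' _ (lie_mem_left K 𝔤 N n y n.2)] }
  have : Nontrivial W := nontrivial_max_triv_of_isNilpotent K N V
  have hv : v ∈ W := by
    rw [LieSubmodule.eq_top_of_isIrreducible K 𝔤 V W]; exact LieSubmodule.mem_top v
  exact hv ⟨x, hx⟩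

variable [CharZero K]

/-- If `I` is a solvable ideal of `𝔤`, then `⁅𝔤, I⁆` acts trivially on every irreducible module. -/
theorem lie_lie_eq_zero_of_derivedSeriesOfIdeal_eq_bot [IsIrreducible K 𝔤 V] (k : ℕ)
    (I : LieIdeal K 𝔤) (hI : LieAlgebra.derivedSeriesOfIdeal K 𝔤 k I = ⊥) (x : 𝔤) {s : 𝔤}
    (hs : s ∈ I) (v : V) : ⁅⁅x, s⁆, v⁆ = 0 := by
  induction k generalizing I x s v with
  | zero =>
    obtain rfl : I = ⊥ := hI
    rw [(LieSubmodule.mem_bot s).1 hs, lie_zero, zero_lie]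
  | succ k ih =>
    rw [LieAlgebra.derivedSeriesOfIdeal_add] at hI
    replace ih := ih _ hI
    have hDcomm (x : 𝔤) {d : 𝔤} (hd : d ∈ ⁅I, I⁆) :
        Commute (toEnd K 𝔤 V x) (toEnd K 𝔤 V d) :=
      commute_toEnd_of_lie_lie_eq_zero (ih x hd)
    have hnil {a b : 𝔤} (h : Commute (toEnd K 𝔤 V ⁅a, b⁆) (toEnd K 𝔤 V b)) :
        IsNilpotent (toEnd K 𝔤 V ⁅a, b⁆) := by
      have hab : toEnd K 𝔤 V ⁅a, b⁆ = ⁅toEnd K 𝔤 V a, toEnd K 𝔤 V b⁆ := by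
        ext v; simp [Ring.lie_def]
      rw [hab] at h ⊢
      exact isNilpotent_lie_of_commute h
    have hadd (A : LieIdeal K 𝔤)
        (hJ : ∀ y ∈ ⁅A, I⁆, ∀ z ∈ ⁅A, I⁆, Commute (toEnd K 𝔤 V y) (toEnd K 𝔤 V z))
        (hA : ∀ a ∈ A, ∀ b ∈ I, Commute (toEnd K 𝔤 V ⁅a, b⁆) (toEnd K 𝔤 V b))
        {y : 𝔤} (hy : y ∈ ⁅A, I⁆) (v : V) : ⁅y, v⁆ = 0 := by
      refine lie_eq_zero_of_isIrreducible_of_isNilpotent (K := K) ⁅A, I⁆ (fun z hz ↦ ?_) hy v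
      have hz' : z ∈ Submodule.span K {⁅x, n⁆ | (x ∈ A) (n ∈ I)} := by
        rw [← LieSubmodule.lieIdeal_oper_eq_linear_span']; exact hz
      clear hy hz
      have hmem {z} (hz : z ∈ Submodule.span K {⁅x, n⁆ | (x ∈ A) (n ∈ I)}) : z ∈ ⁅A, I⁆ := by
        rw [← LieSubmodule.lieIdeal_oper_eq_linear_span'] at hz; exact hz
      induction hz' using Submodule.span_induction with
      | mem z h =>
        obtain ⟨a, ha, b, hb, rfl⟩ := h
        exact hnil (hA a ha b hb)
      | zero => simp
      | add y z hy hz ihy ihz =>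
        rw [map_add]
        exact (hJ y (hmem hy) z (hmem hz)).isNilpotent_add ihy ihz
      | smul r z hz ihz =>
        rw [map_smul]
        exact ihz.smul r
    have hD {d : 𝔤} (hd : d ∈ ⁅I, I⁆) (v : V) : ⁅d, v⁆ = 0 :=
      hadd I (fun y _ z hz ↦ hDcomm y hz)
        (fun a ha b hb ↦ (hDcomm b (LieSubmodule.lie_mem_lie ha hb)).symm) hd v
    have hIcomm {a b : 𝔤} (ha : a ∈ I) (hb : b ∈ I) :
        Commute (toEnd K 𝔤 V a) (toEnd K 𝔤 V b) :=
      commute_toEnd_of_lie_lie_eq_zero (hD (LieSubmodule.lie_mem_lie ha hb))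
    refine hadd ⊤ (fun y hy z hz ↦ ?_) (fun a _ b hb ↦ ?_)
      (LieSubmodule.lie_mem_lie (LieSubmodule.mem_top x) hs) v
    · exact hIcomm (LieSubmodule.lie_le_right _ _ hy) (LieSubmodule.lie_le_right _ _ hz)
    · exact hIcomm (lie_mem_right K 𝔤 I a b hb) hb

/-- If `I` is a solvable ideal then `⁅x, s⁆ y`, for `s ∈ I`, acts nilpotently on every
finite-dimensional module. -/
theorem isNilpotent_toEnd_lie_mul (I : LieIdeal K 𝔤) [LieAlgebra.IsSolvable I] (x y : 𝔤) {s : 𝔤}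
    (hs : s ∈ I) : IsNilpotent (toEnd K 𝔤 V ⁅x, s⁆ * toEnd K 𝔤 V y) := by
  obtain ⟨d, hd⟩ : ∃ d, finrank K V = d := ⟨_, rfl⟩
  induction d using Nat.strong_induction_on generalizing V with
  | _ d ih =>
    obtain hV | hV := subsingleton_or_nontrivial V
    · exact ⟨1, Subsingleton.elim _ _⟩
    obtain h | ⟨W, hW, -⟩ := eq_bot_or_exists_atom_le (⊤ : LieSubmodule K 𝔤 V)
    · exact absurd h top_ne_bot
    have := isIrreducible_of_isAtom hW
    obtain ⟨k, hk⟩ := LieAlgebra.IsSolvable.solvable K I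
    rw [LieIdeal.derivedSeries_eq_bot_iff] at hk
    have hzero (w : V) (hw : w ∈ W) : ⁅⁅x, s⁆, w⁆ = 0 :=
      congrArg Subtype.val
        (lie_lie_eq_zero_of_derivedSeriesOfIdeal_eq_bot k I hk x hs (⟨w, hw⟩ : W))
    have hlt : finrank K (V ⧸ W) < d := by
      have : Nontrivial W := (LieSubmodule.nontrivial_iff_ne_bot K 𝔤 V).2 hW.1
      have h1 : 0 < finrank K W := finrank_pos
      have h2 := W.toSubmodule.finrank_quotient_add_finrank
      change finrank K (V ⧸ W) + finrank K W = _ at h2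
      omega
    obtain ⟨n, hn⟩ := ih _ hlt (V := V ⧸ W) rfl
    have hmk (v : V) : LieSubmodule.Quotient.mk (N := W)
        (((toEnd K 𝔤 V ⁅x, s⁆ * toEnd K 𝔤 V y) ^ n) v) =
        ((toEnd K 𝔤 (V ⧸ W) ⁅x, s⁆ * toEnd K 𝔤 (V ⧸ W) y) ^ n)
          (LieSubmodule.Quotient.mk (N := W) v) := by
      clear hn
      induction n with
      | zero => rfl
      | succ n ihn =>
        rw [pow_succ', pow_succ', Module.End.mul_apply _ (_ ^ n),
          Module.End.mul_apply _ (_ ^ n), ← ihn]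
        rfl
    refine ⟨n + 1, LinearMap.ext fun v ↦ ?_⟩
    rw [pow_succ', Module.End.mul_apply]
    refine hzero _ (W.lie_mem ?_)
    rw [LieSubmodule.mem_carrier, SetLike.mem_coe]
    rw [← LieSubmodule.Quotient.mk_eq_zero', hmk, hn, LinearMap.zero_apply]

theorem killingForm_apply_lie_eq_zero_of_mem_radical [FiniteDimensional K 𝔤] {r : 𝔤}
    (hr : r ∈ LieAlgebra.radical K 𝔤) (x y : 𝔤) : killingForm K 𝔤 r ⁅x, y⁆ = 0 := by
  rw [← traceForm_apply_lie_apply, ← lie_skew, map_neg, LinearMap.neg_apply, neg_eq_zero]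
  exact (LinearMap.isNilpotent_trace_of_isNilpotent
    (isNilpotent_toEnd_lie_mul (LieAlgebra.radical K 𝔤) x y hr)).eq_zero

/-- The radical of a Lie algebra is the orthogonal of its derived algebra for the Killing form. -/
theorem mem_radical_iff_killingForm [FiniteDimensional K 𝔤] {r : 𝔤} :
    r ∈ LieAlgebra.radical K 𝔤 ↔ ∀ x y : 𝔤, killingForm K 𝔤 r ⁅x, y⁆ = 0 := by
  refine ⟨killingForm_apply_lie_eq_zero_of_mem_radical, fun h ↦ ?_⟩
  let J : LieIdeal K 𝔤 := LieIdeal.killingCompl K 𝔤 ⁅(⊤ : LieIdeal K 𝔤), (⊤ : LieIdeal K 𝔤)⁆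
  have hJ : LieAlgebra.IsSolvable J := by
    refine LieIdeal.isSolvable_of_killingForm_apply_lie_eq_zero _ fun x hx y hy ↦ ?_
    rw [traceForm_comm]
    exact (LieIdeal.mem_killingCompl K 𝔤 _).1 hx y (LieSubmodule.mono_lie le_top le_top hy)
  refine (LieAlgebra.LieIdeal.solvable_iff_le_radical K 𝔤 J).1 hJ
    ((LieIdeal.mem_killingCompl K 𝔤 _).2 ?_)
  intro z hz
  rw [← LieSubmodule.mem_toSubmodule, LieSubmodule.lieIdeal_oper_eq_linear_span'] at hz
  rw [traceForm_comm]
  induction hz using Submodule.span_induction with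
  | mem z hz =>
    obtain ⟨x, -, y, -, rfl⟩ := hz
    exact h x y
  | zero => exact map_zero _
  | add a b _ _ ha hb => rw [map_add, ha, hb, add_zero]
  | smul c a _ ha => rw [map_smul, ha, smul_zero]

end Radical

section Comodule

open Module

theorem trace_smul_map_mul_smul_map {K ι H : Type*} [Field K] [Ring H] [Algebra K H] [Fintype ι]
    (u v : H) (A B : Matrix ι ι K) :
    ((u • A.map (algebraMap K H)) * (v • B.map (algebraMap K H))).trace =
      (A * B).trace • (u * v) := by
  simp only [Matrix.trace, Matrix.diag_apply, Matrix.mul_apply, Matrix.smul_apply,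
    Matrix.map_apply, smul_eq_mul, Finset.sum_smul, ← Algebra.commutes, ← Algebra.smul_def,
    smul_mul_smul_comm]

/-- Let `m * m' = 1` and let the transpose of `m'` be right inverse to the transpose of `m`. If the
scalar matrices `A j` satisfy `m * A j = (∑ p, m p j • A p) * m`, then the trace form
`(A i, A j) ↦ trace (A i * A j)` is invariant under `m`. -/
theorem sum_trace_smul_mul_eq {K ι H : Type*} [Field K] [Ring H] [Algebra K H] [Fintype ι]
    [DecidableEq ι] {m m' : Matrix ι ι H} {A : ι → Matrix ι ι K} (hm : m * m' = 1)
    (hm' : ∀ i j, ∑ k, m k j * m' i k = if i = j then 1 else 0)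
    (hA : ∀ j, m * (A j).map (algebraMap K H) =
      (∑ p, m p j • (A p).map (algebraMap K H)) * m) (i j : ι) :
    ∑ p, ∑ q, (A p * A q).trace • (m p i * m q j) = algebraMap K H (A i * A j).trace := by
  set B : ι → Matrix ι ι H := fun j ↦ ∑ p, m p j • (A p).map (algebraMap K H) with hB
  have hmul : B i * B j = m * (A i * A j).map (algebraMap K H) * m' := by
    rw [Matrix.map_mul, ← mul_assoc, hA i, mul_assoc (B i), hA j, mul_assoc, mul_assoc, hm,
      mul_one]
  have hleft : (B i * B j).trace = ∑ p, ∑ q, (A p * A q).trace • (m p i * m q j) := by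
    simp only [hB, Finset.sum_mul, Finset.mul_sum, Matrix.trace_sum]
    rw [Finset.sum_comm]
    simp only [trace_smul_map_mul_smul_map]
  have hright (X : Matrix ι ι K) :
      (m * X.map (algebraMap K H) * m').trace = algebraMap K H X.trace := by
    calc (m * X.map (algebraMap K H) * m').trace
        = ∑ b, ∑ c, algebraMap K H (X b c) * ∑ a, m a b * m' c a := by
          simp only [Matrix.trace, Matrix.diag_apply, Matrix.mul_apply, Matrix.map_apply,
            Finset.sum_mul, Finset.mul_sum]
          rw [Finset.sum_congr rfl fun a _ ↦ Finset.sum_comm, Finset.sum_comm]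
          refine Finset.sum_congr rfl fun b _ ↦ ?_
          rw [Finset.sum_comm]
          refine Finset.sum_congr rfl fun c _ ↦ Finset.sum_congr rfl fun a _ ↦ ?_
          rw [← Algebra.commutes, mul_assoc]
      _ = algebraMap K H X.trace := by
          simp [hm', Matrix.trace]
  rw [← hleft, hmul, hright]

section Coefficients

variable {K ι V C : Type*} [Field K] [AddCommGroup V] [Module K V] [AddCommGroup C] [Module K C]
  [Fintype ι] [DecidableEq ι]

/-- The matrix of coefficients of a coaction with respect to a basis. -/
noncomputable def coactionMatrix (b : Basis ι K V) (ρ : V →ₗ[K] V ⊗[K] C) : Matrix ι ι C :=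
  Matrix.of fun i j ↦ TensorProduct.equivFinsuppOfBasisLeft b (ρ (b j)) i

theorem coaction_basis_eq_sum (b : Basis ι K V) (ρ : V →ₗ[K] V ⊗[K] C) (j : ι) :
    ρ (b j) = ∑ i, b i ⊗ₜ[K] coactionMatrix b ρ i j := by
  rw [← (TensorProduct.equivFinsuppOfBasisLeft b).symm_apply_apply (ρ (b j)),
    TensorProduct.equivFinsuppOfBasisLeft_symm_apply, Finsupp.sum_fintype _ _ (by simp)]
  rfl

theorem eq_of_sum_basis_tmul_eq (b : Basis ι K V) {f g : ι → C}
    (h : ∑ i, b i ⊗ₜ[K] f i = ∑ i, b i ⊗ₜ[K] g i) : f = g := by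
  ext i
  have := congrArg (fun t ↦ TensorProduct.equivFinsuppOfBasisLeft b t i) h
  simpa [TensorProduct.equivFinsuppOfBasisLeft_apply_tmul_apply, Finsupp.single_apply] using this

theorem counit_coactionMatrix [Coalgebra K C] (b : Basis ι K V) (ρ : V →ₗ[K] V ⊗[K] C)
    (hcounit : ∀ a : V, TensorProduct.rid K V
      (LinearMap.lTensor V (Coalgebra.counit (R := K) (A := C)) (ρ a)) = a) (i j : ι) :
    Coalgebra.counit (R := K) (coactionMatrix b ρ i j) = if i = j then 1 else 0 := by
  have h := hcounit (b j)
  rw [coaction_basis_eq_sum] at h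
  simp only [map_sum, LinearMap.lTensor_tmul, TensorProduct.rid_tmul] at h
  have := congrArg (fun v ↦ b.repr v i) h
  simpa [Finsupp.single_apply, eq_comm] using this

theorem comul_coactionMatrix [Coalgebra K C] (b : Basis ι K V) (ρ : V →ₗ[K] V ⊗[K] C)
    (hcoassoc : ∀ a : V, TensorProduct.assoc K V C C (LinearMap.rTensor C ρ (ρ a)) =
      LinearMap.lTensor V (Coalgebra.comul (R := K) (A := C)) (ρ a)) (i j : ι) :
    Coalgebra.comul (R := K) (coactionMatrix b ρ i j) =
      ∑ k, coactionMatrix b ρ i k ⊗ₜ[K] coactionMatrix b ρ k j := by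
  have h := hcoassoc (b j)
  rw [coaction_basis_eq_sum] at h
  simp only [map_sum, LinearMap.lTensor_tmul, LinearMap.rTensor_tmul, coaction_basis_eq_sum b ρ,
    TensorProduct.sum_tmul, TensorProduct.assoc_tmul] at h
  rw [Finset.sum_comm] at h
  simp only [← TensorProduct.tmul_sum] at h
  exact congrFun (eq_of_sum_basis_tmul_eq b h.symm) i

theorem coactionMatrix_mul_map_antipode {H : Type*} [Ring H] [HopfAlgebra K H] (b : Basis ι K V)
    (ρ : V →ₗ[K] V ⊗[K] H)
    (hcoassoc : ∀ a : V, TensorProduct.assoc K V H H (LinearMap.rTensor H ρ (ρ a)) =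
      LinearMap.lTensor V (Coalgebra.comul (R := K) (A := H)) (ρ a))
    (hcounit : ∀ a : V, TensorProduct.rid K V
      (LinearMap.lTensor V (Coalgebra.counit (R := K) (A := H)) (ρ a)) = a) :
    coactionMatrix b ρ * (coactionMatrix b ρ).map (HopfAlgebra.antipode K) = 1 := by
  ext i j
  have h := HopfAlgebra.mul_antipode_lTensor_comul_apply (R := K) (coactionMatrix b ρ i j)
  rw [comul_coactionMatrix b ρ hcoassoc, counit_coactionMatrix b ρ hcounit] at h
  simp only [map_sum, LinearMap.lTensor_tmul, LinearMap.mul'_apply] at h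
  rw [Matrix.mul_apply, Matrix.one_apply]
  simpa using h

/-- A tensor whose left components are killed by all functionals cutting out `W` lies in
`W ⊗ C`. -/
theorem mem_range_rTensor_subtype {κ : Type*} (W : Submodule K V) (f : κ → Dual K V)
    (hW : ∀ v, (∀ k, f k v = 0) → v ∈ W) (t : V ⊗[K] C)
    (ht : ∀ k, TensorProduct.lid K C (LinearMap.rTensor C (f k) t) = 0) :
    t ∈ LinearMap.range (LinearMap.rTensor C W.subtype) := by
  let c := Basis.ofVectorSpace K C
  obtain ⟨a, rfl⟩ := TensorProduct.eq_repr_basis_right c t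
  refine Submodule.sum_mem _ fun i hi ↦ ?_
  have ha : a i ∈ W := by
    refine hW _ fun k ↦ linearIndependent_iff'.1 c.linearIndependent a.support
      (fun i ↦ f k (a i)) ?_ i hi
    simpa [Finsupp.sum] using ht k
  exact ⟨⟨a i, ha⟩ ⊗ₜ c i, rfl⟩

end Coefficients

variable {K ι 𝔤 H : Type*} [Field K] [LieRing 𝔤] [LieAlgebra K 𝔤] [Ring H]

theorem tensorLieMul_tmul_tmul [Algebra K H] (x y : 𝔤) (h q : H) :
    tensorLieMul (F := K) (x ⊗ₜ h) (y ⊗ₜ q) = ⁅x, y⁆ ⊗ₜ (h * q) := by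
  simp [tensorLieMul]

theorem rTensor_tensorLieMul_eq_zero [Algebra K H] (f : Dual K 𝔤) (hf : ∀ x y : 𝔤, f ⁅x, y⁆ = 0)
    (s t : 𝔤 ⊗[K] H) : LinearMap.rTensor H f (tensorLieMul s t) = 0 := by
  induction s with
  | zero => simp
  | add s s' hs hs' => simp [hs, hs']
  | tmul x h =>
    induction t with
    | zero => simp
    | add t t' ht ht' => simp [ht, ht']
    | tmul y q => simp [tensorLieMul_tmul_tmul, hf]

theorem coactionMatrix_mul_toMatrix_ad [Algebra K H] [Fintype ι] [DecidableEq ι]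
    (b : Basis ι K 𝔤) (ρ : 𝔤 →ₗ[K] 𝔤 ⊗[K] H)
    (hbracket : ∀ x y : 𝔤, ρ ⁅x, y⁆ = tensorLieMul (ρ x) (ρ y)) (j : ι) :
    coactionMatrix b ρ *
        (LinearMap.toMatrix b b (LieAlgebra.ad K 𝔤 (b j))).map (algebraMap K H) =
      (∑ p, coactionMatrix b ρ p j •
        (LinearMap.toMatrix b b (LieAlgebra.ad K 𝔤 (b p))).map (algebraMap K H)) *
        coactionMatrix b ρ := by
  set m := coactionMatrix b ρ
  set A : ι → Matrix ι ι K := fun i ↦ LinearMap.toMatrix b b (LieAlgebra.ad K 𝔤 (b i)) with hA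
  have hlie (i k : ι) : ⁅b i, b k⁆ = ∑ l, A i l k • b l := by
    conv_lhs => rw [← b.sum_repr ⁅b i, b k⁆]
    simp [hA, LinearMap.toMatrix_apply]
  ext l k
  have h := hbracket (b j) (b k)
  rw [hlie, map_sum] at h
  simp only [map_smul, coaction_basis_eq_sum b ρ, map_sum, LinearMap.sum_apply,
    tensorLieMul_tmul_tmul, hlie, TensorProduct.sum_tmul, Finset.smul_sum,
    TensorProduct.smul_tmul] at h
  conv_lhs at h => rw [Finset.sum_comm]
  conv_rhs at h =>
    enter [2, q]
    rw [Finset.sum_comm]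
  conv_rhs at h => rw [Finset.sum_comm]
  simp only [← TensorProduct.tmul_smul, ← TensorProduct.tmul_sum] at h
  have hl := congrFun (eq_of_sum_basis_tmul_eq b h) l
  simp only [Matrix.mul_apply, Matrix.sum_apply, Matrix.smul_apply, Matrix.map_apply, smul_eq_mul,
    ← Algebra.commutes, ← Algebra.smul_def, Finset.sum_mul, smul_mul_assoc]
  exact hl

variable [HopfAlgebra K H] [FiniteDimensional K 𝔤]

/-- The Killing form of a comodule Lie algebra over an involutory Hopf algebra intertwines the
coaction on its two arguments via the antipode. -/
theorem lid_rTensor_killingForm_eq_antipode (ρ : 𝔤 →ₗ[K] 𝔤 ⊗[K] H)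
    (hcoassoc : ∀ a : 𝔤, TensorProduct.assoc K 𝔤 H H (LinearMap.rTensor H ρ (ρ a)) =
      LinearMap.lTensor 𝔤 (Coalgebra.comul (R := K) (A := H)) (ρ a))
    (hcounit : ∀ a : 𝔤, TensorProduct.rid K 𝔤
      (LinearMap.lTensor 𝔤 (Coalgebra.counit (R := K) (A := H)) (ρ a)) = a)
    (hbracket : ∀ x y : 𝔤, ρ ⁅x, y⁆ = tensorLieMul (ρ x) (ρ y))
    (hinv : ∀ h : H, HopfAlgebra.antipode K (HopfAlgebra.antipode K h) = h) (x y : 𝔤) :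
    TensorProduct.lid K H (LinearMap.rTensor H ((killingForm K 𝔤).flip y) (ρ x)) =
      HopfAlgebra.antipode K
        (TensorProduct.lid K H (LinearMap.rTensor H (killingForm K 𝔤 x) (ρ y))) := by
  let b := finBasis K 𝔤
  let m := coactionMatrix b ρ
  let S : H →ₗ[K] H := HopfAlgebra.antipode K
  let A i := LinearMap.toMatrix b b (LieAlgebra.ad K 𝔤 (b i))
  have hm : m * m.map S = 1 := coactionMatrix_mul_map_antipode b ρ hcoassoc hcounit
  have hentry (i j) : ∑ k, m i k * S (m k j) = if i = j then 1 else 0 := by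
    simpa [Matrix.mul_apply, Matrix.one_apply] using congrFun (congrFun hm i) j
  have hm' (i j) : ∑ k, m k j * m.map S i k = if i = j then 1 else 0 := by
    have h := congrArg S (hentry i j)
    rw [map_sum, apply_ite S, map_zero] at h
    simpa [S, HopfAlgebra.antipode_mul_antidistrib, hinv, HopfAlgebra.antipode_one] using h
  have hA (p q) : (A p * A q).trace = killingForm K 𝔤 (b p) (b q) := by
    rw [killingForm_apply_apply, LinearMap.trace_eq_matrix_trace K b, LinearMap.toMatrix_comp b b b]
  have hinvariant (i j) := sum_trace_smul_mul_eq hm hm'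
    (coactionMatrix_mul_toMatrix_ad b ρ hbracket) i j
  have hbasis (i k) : ∑ p, killingForm K 𝔤 (b p) (b k) • m p i =
      ∑ j, killingForm K 𝔤 (b i) (b j) • S (m j k) := by
    have h : ∑ j, (∑ p, ∑ q, (A p * A q).trace • (m p i * m q j)) * S (m j k) =
        ∑ j, algebraMap K H (A i * A j).trace * S (m j k) :=
      Finset.sum_congr rfl fun j _ ↦ congrArg (· * S (m j k)) (hinvariant i j)
    simp only [hA, ← Algebra.smul_def] at h
    rw [← h]
    simp only [Finset.sum_mul, smul_mul_assoc, mul_assoc]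
    rw [Finset.sum_comm]
    refine Finset.sum_congr rfl fun p _ ↦ ?_
    rw [Finset.sum_comm]
    simp [← Finset.smul_sum, ← Finset.mul_sum, hentry]
  let B₁ : 𝔤 →ₗ[K] 𝔤 →ₗ[K] H := LinearMap.mk₂ K
    (fun x y ↦ TensorProduct.lid K H (LinearMap.rTensor H ((killingForm K 𝔤).flip y) (ρ x)))
    (by simp) (by simp) (by simp [LinearMap.rTensor_add]) (by simp [LinearMap.rTensor_smul])
  let B₂ : 𝔤 →ₗ[K] 𝔤 →ₗ[K] H := LinearMap.mk₂ K
    (fun x y ↦ S (TensorProduct.lid K H (LinearMap.rTensor H (killingForm K 𝔤 x) (ρ y))))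
    (by simp [LinearMap.rTensor_add]) (by simp [LinearMap.rTensor_smul]) (by simp) (by simp)
  have hB : B₁ = B₂ := by
    refine b.ext fun i ↦ b.ext fun k ↦ ?_
    simpa [B₁, B₂, coaction_basis_eq_sum b ρ] using hbasis i k
  exact congrFun (congrArg DFunLike.coe (congrArg (· x) (congrArg DFunLike.coe hB))) y

end Comodule

/-- the solvable radical of a finite-dimensional `H`-comodule Lie algebra over a
field of characteristic `0`, for an involutory Hopf algebra `H`, is an `H`-subcomodule. -/
theorem stmt8 [Field F] [CharZero F] [Ring H] [HopfAlgebra F H]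
    [LieRing L] [LieAlgebra F L] [FiniteDimensional F L]
    (ρ : L →ₗ[F] L ⊗[F] H)
    (hcoassoc : ∀ a : L, (TensorProduct.assoc F L H H)
        ((LinearMap.rTensor H ρ) (ρ a))
      = (LinearMap.lTensor L (Coalgebra.comul (R := F) (A := H))) (ρ a))
    (hcounit : ∀ a : L, (TensorProduct.rid F L)
        ((LinearMap.lTensor L (Coalgebra.counit (R := F) (A := H))) (ρ a)) = a)
    (hbracket : ∀ a b : L, ρ ⁅a, b⁆ = tensorLieMul (ρ a) (ρ b))
    (hinv : ∀ h : H, HopfAlgebra.antipode (R := F)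
      (HopfAlgebra.antipode (R := F) h) = h) :
    IsSubcomodule ρ (LieSubmodule.toSubmodule (LieAlgebra.radical F L)) := by
  intro x hx
  refine mem_range_rTensor_subtype _ (fun u : L × L ↦ (killingForm F L).flip ⁅u.1, u.2⁆)
    (fun v hv ↦ mem_radical_iff_killingForm.2 fun y z ↦ hv (y, z)) _ fun u ↦ ?_
  rw [lid_rTensor_killingForm_eq_antipode ρ hcoassoc hcounit hbracket hinv, hbracket,
    rTensor_tensorLieMul_eq_zero _ (mem_radical_iff_killingForm.1 hx), map_zero, map_zero]
end

section
/- Let G be a group, F a field of characteristic 0, and let A = ⊕_{g∈G} A^{(g)} be a finite-dimensional associative G-graded algebra over F that is not nilpotent (i.e. A^n ≠ 0 for all n). Then there exist constants C₁, C₂ > 0, real numbers r₁, r₂ ∈ ℝ, and a positive integer d ∈ ℕ such that C₁ · n^{r₁} · d^n ≤ c_n^gr(A) ≤ C₂ · n^{r₂} · d^n for all n ∈ ℕ. -/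
/-- The ideal of graded polynomial identities of a `G`-graded algebra `A` with grading `𝒜`,
inside the free `G`-graded associative algebra `F⟨X^gr⟩ = FreeAlgebra F (ℕ × G)` on the
variables `x_i^{(g)} = ι (i, g)`: those `f` killed by every algebra homomorphism sending each
variable `x_i^{(g)}` into `𝒜 g`. -/
def gradedIdentities (F : Type*) [Field F] {G : Type*} {A : Type*} [Ring A] [Algebra F A]
    (𝒜 : G → Submodule F A) : Submodule F (FreeAlgebra F (ℕ × G)) where
  carrier := {f | ∀ φ : FreeAlgebra F (ℕ × G) →ₐ[F] A,
    (∀ (i : ℕ) (g : G), φ (FreeAlgebra.ι F (i, g)) ∈ 𝒜 g) → φ f = 0}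
  add_mem' := by
    intro x y hx hy φ hφ
    rw [map_add, hx φ hφ, hy φ hφ, add_zero]
  zero_mem' := by
    intro φ _
    exact map_zero φ
  smul_mem' := by
    intro c x hx φ hφ
    rw [map_smul, hx φ hφ, smul_zero]

/-- The space `P_n^gr` of multilinear graded polynomials in `x_1, …, x_n`: the span of the
monomials `x_{σ(1)}^{(g_1)} ⋯ x_{σ(n)}^{(g_n)}`, `σ ∈ S_n`, `g_i ∈ G`. -/
def multilinearGradedPolys (F : Type*) [Field F] (G : Type*) (n : ℕ) :
    Submodule F (FreeAlgebra F (ℕ × G)) :=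
  Submodule.span F {x | ∃ (σ : Equiv.Perm (Fin n)) (g : Fin n → G),
    x = (List.ofFn fun k => FreeAlgebra.ι F (((σ k : Fin n) : ℕ), g k)).prod}

/-- The `n`-th graded codimension `c_n^gr(A) = dim_F (P_n^gr / (P_n^gr ∩ Id^gr(A)))`. -/
noncomputable def gradedCodim (F : Type*) [Field F] {G : Type*} {A : Type*} [Ring A]
    [Algebra F A] (𝒜 : G → Submodule F A) (n : ℕ) : ℕ :=
  Module.finrank F (↥(multilinearGradedPolys F G n) ⧸
    (Submodule.comap (multilinearGradedPolys F G n).subtype (gradedIdentities F 𝒜)))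

/-- The homogeneous projections of a grading with finite support. -/
structure GradingProj (F A G : Type*) [Field F] [Ring A] [Algebra F A] [Group G] where
  /-- The projection onto a homogeneous component. -/
  proj : G → A →ₗ[F] A
  /-- A finite set containing the support. -/
  supp : Finset G
  proj_proj_same : ∀ g a, proj g (proj g a) = proj g a
  proj_proj_ne : ∀ g h a, g ≠ h → proj g (proj h a) = 0
  sum_proj : ∀ a, ∑ g ∈ supp, proj g a = a
  proj_eq_zero : ∀ g, g ∉ supp → proj g = 0
  proj_mul_self : ∀ g h a b, proj (g * h) (proj g a * proj h b) = proj g a * proj h b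

namespace GradingProj

section Basic

variable {F A G : Type*} [Field F] [Ring A] [Algebra F A] [Group G] (P : GradingProj F A G)

/-- The function computed by a graded monomial, all degrees of a variable being read off
from one argument. -/
def mon (l : List (ℕ × G)) (a : ℕ → A) : A := (l.map fun p => P.proj p.2 (a p.1)).prod

@[simp] lemma mon_nil (a : ℕ → A) : P.mon [] a = 1 := rfl

@[simp] lemma mon_cons (p : ℕ × G) (l : List (ℕ × G)) (a : ℕ → A) :
    P.mon (p :: l) a = P.proj p.2 (a p.1) * P.mon l a := by
  simp [mon]

/-- The functions computed by the multilinear graded polynomials in the first `n` variables. -/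
def multilin (n : ℕ) : Submodule F ((ℕ → A) → A) :=
  Submodule.span F {f | ∃ l : List (ℕ × G), (l.map Prod.fst).Perm (List.range n) ∧ f = P.mon l}

/-- The codimension, as the dimension of a space of functions. -/
noncomputable def codim (n : ℕ) : ℕ := Module.finrank F (P.multilin n)

lemma mon_congr {l : List (ℕ × G)} {a b : ℕ → A} (h : ∀ v ∈ l.map Prod.fst, a v = b v) :
    P.mon l a = P.mon l b := by
  unfold mon
  congr 1
  refine List.map_congr_left fun p hp => ?_
  rw [h _ (List.mem_map_of_mem hp)]

end Basic

lemma perm_range_iff {G : Type*} {n : ℕ} (l : List (ℕ × G)) :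
    (l.map Prod.fst).Perm (List.range n) ↔ ∃ (σ : Equiv.Perm (Fin n)) (g : Fin n → G),
      l = List.ofFn fun k => (((σ k : Fin n) : ℕ), g k) := by
  constructor
  · intro h
    have hlen : l.length = n := by simpa using h.length_eq
    subst hlen
    have hlt : ∀ k : Fin l.length, (l.get k).1 < l.length := fun k => by
      have : (l.get k).1 ∈ List.range l.length :=
        h.mem_iff.1 (List.mem_map_of_mem (List.get_mem l k))
      simpa using this
    have hnd : (l.map Prod.fst).Nodup := h.nodup_iff.2 List.nodup_range
    have hinj : Function.Injective fun k : Fin l.length =>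
        (⟨(l.get k).1, hlt k⟩ : Fin l.length) := by
      intro i j hij
      have h1 : (l.get i).1 = (l.get j).1 := by simpa using hij
      have h2 := (List.nodup_iff_injective_get.1 hnd)
        (a₁ := ⟨i, by simp⟩) (a₂ := ⟨j, by simp⟩) (by simpa using h1)
      ext
      simpa using h2
    refine ⟨Equiv.ofBijective _ (Finite.injective_iff_bijective.1 hinj), fun k => (l.get k).2, ?_⟩
    apply List.ext_get <;> simp
  · rintro ⟨σ, g, rfl⟩
    rw [List.map_ofFn]
    refine (List.perm_ext_iff_of_nodup ?_ List.nodup_range).2 fun v => ?_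
    · rw [List.nodup_ofFn]
      intro i j hij
      exact σ.injective (Fin.ext hij)
    · simp only [List.mem_ofFn, List.mem_range, Function.comp_apply]
      constructor
      · rintro ⟨k, rfl⟩
        exact (σ k).2
      · intro hv
        exact ⟨σ.symm ⟨v, hv⟩, by simp⟩

section Codim

variable {F A G : Type*} [Field F] [Ring A] [Algebra F A] [Group G] (P : GradingProj F A G)

lemma exists_multilinearMap {n : ℕ} {f : (ℕ → A) → A} (hf : f ∈ P.multilin n) :
    ∃ Φ : MultilinearMap F (fun _ : Fin n => A) A, ∀ a, f a = Φ fun k => a k := by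
  induction hf using Submodule.span_induction with
  | mem f hf =>
    obtain ⟨l, hl, rfl⟩ := hf
    obtain ⟨σ, g, rfl⟩ := (perm_range_iff l).1 hl
    refine ⟨((MultilinearMap.mkPiAlgebraFin F n A).compLinearMap
      fun k => P.proj (g k)).domDomCongr σ, fun a => ?_⟩
    simp [mon, List.map_ofFn, Function.comp_def]
  | zero => exact ⟨0, fun a => rfl⟩
  | add f g _ _ hf hg =>
    obtain ⟨Φ, hΦ⟩ := hf
    obtain ⟨Ψ, hΨ⟩ := hg
    exact ⟨Φ + Ψ, fun a => by simp [hΦ, hΨ]⟩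
  | smul c f _ hf =>
    obtain ⟨Φ, hΦ⟩ := hf
    exact ⟨c • Φ, fun a => by simp [hΦ]⟩

/-- Extension of a finite tuple by zero. -/
def extendZero {n : ℕ} (a : Fin n → A) (v : ℕ) : A := if h : v < n then a ⟨v, h⟩ else 0

lemma extendZero_val {n : ℕ} (a : Fin n → A) (k : Fin n) : extendZero a k = a k := by
  simp [extendZero]

lemma eq_zero_of_basis {n : ℕ} {f : (ℕ → A) → A} (hf : f ∈ P.multilin n) {ι : Type*}
    [Finite ι] (b : Module.Basis ι F A)
    (h : ∀ t : Fin n → ι, f (extendZero fun k => b (t k)) = 0) : f = 0 := by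
  obtain ⟨Φ, hΦ⟩ := P.exists_multilinearMap hf
  have : Φ = 0 := by
    refine Module.Basis.ext_multilinear (fun _ => b) fun t => ?_
    have := h t
    rw [hΦ] at this
    simpa [extendZero_val] using this
  ext a
  simp [hΦ, this]

/-- Evaluation of functions at tuples of basis vectors. -/
noncomputable def evalBasis {ι : Type*} (b : Module.Basis ι F A) (n : ℕ) :
    ((ℕ → A) → A) →ₗ[F] ((Fin n → ι) → A) where
  toFun f t := f (extendZero fun k => b (t k))
  map_add' _ _ := rfl
  map_smul' _ _ := rfl

lemma codim_eq_evalBasis {ι : Type*} [Finite ι] (b : Module.Basis ι F A) (n : ℕ) :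
    P.codim n = Module.finrank F ((P.multilin n).map (evalBasis b n)) := by
  have hinj : Function.Injective ((evalBasis b n).domRestrict (P.multilin n)) := by
    rw [injective_iff_map_eq_zero]
    rintro ⟨f, hf⟩ h
    have := P.eq_zero_of_basis hf b fun t => congrFun h t
    exact Subtype.ext this
  rw [← LinearMap.range_domRestrict]
  exact (LinearMap.finrank_range_of_inj hinj).symm

end Codim

end GradingProj

lemma finrank_span_algebraMap {F K : Type*} [Field F] [Field K] [Algebra F K] {S T : Type*}
    [Finite T] (v : S → T → F) :
    Module.finrank K (Submodule.span K (Set.range fun s => algebraMap F K ∘ v s)) =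
      Module.finrank F (Submodule.span F (Set.range v)) := by
  obtain ⟨κ, a, ha, hspan, hli⟩ := exists_linearIndependent' F v
  have : Finite κ := hli.finite
  have hli' : LinearIndependent K fun i => algebraMap F K ∘ (v ∘ a) i :=
    linearIndependent_algebraMap_comp_iff.2 hli
  have hspan' : Submodule.span K (Set.range fun s => algebraMap F K ∘ v s) =
      Submodule.span K (Set.range fun i => algebraMap F K ∘ (v ∘ a) i) := by
    apply le_antisymm
    · rw [Submodule.span_le]
      rintro _ ⟨s, rfl⟩
      have hs : v s ∈ Submodule.span F (Set.range (v ∘ a)) :=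
        hspan ▸ Submodule.subset_span ⟨s, rfl⟩
      simp only [SetLike.mem_coe]
      generalize v s = w at hs
      induction hs using Submodule.span_induction with
      | mem w hw =>
        obtain ⟨i, rfl⟩ := hw
        exact Submodule.subset_span ⟨i, rfl⟩
      | zero =>
        convert! Submodule.zero_mem _
        ext; simp
      | add x y _ _ hx hy =>
        convert! Submodule.add_mem _ hx hy
        ext; simp
      | smul c x _ hx =>
        convert! Submodule.smul_mem _ (algebraMap F K c) hx
        ext; simp
    · apply Submodule.span_mono
      rintro _ ⟨i, rfl⟩
      exact ⟨a i, rfl⟩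
  have := Fintype.ofFinite κ
  rw [hspan', finrank_span_eq_card hli', ← hspan, finrank_span_eq_card hli]

namespace GradingProj

section BaseChange

open TensorProduct

variable {F A G : Type*} [Field F] [Ring A] [Algebra F A] [Group G] (P : GradingProj F A G)
  (K : Type*) [Field K] [Algebra F K]

/-- Extension of scalars. -/
noncomputable def baseChange : GradingProj K (K ⊗[F] A) G where
  proj g := (P.proj g).baseChange K
  supp := P.supp
  proj_proj_same g a := by
    induction a with
    | zero => simp
    | tmul c x => simp [P.proj_proj_same]
    | add x y hx hy => simp [hx, hy]
  proj_proj_ne g h a hgh := by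
    induction a with
    | zero => simp
    | tmul c x => simp [P.proj_proj_ne _ _ _ hgh]
    | add x y hx hy => simp [hx, hy]
  sum_proj a := by
    induction a with
    | zero => simp
    | tmul c x => simp [← TensorProduct.tmul_sum, P.sum_proj]
    | add x y hx hy => simp [Finset.sum_add_distrib, hx, hy]
  proj_eq_zero g hg := by simp [P.proj_eq_zero g hg]
  proj_mul_self g h a b := by
    induction a with
    | zero => simp
    | add x y hx hy => simp [add_mul, hx, hy]
    | tmul c x =>
      induction b with
      | zero => simp
      | add x y hx hy => simp only [map_add, mul_add, hx, hy]
      | tmul d y => simp [P.proj_mul_self]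

lemma baseChange_mon (l : List (ℕ × G)) (a : ℕ → A) :
    (P.baseChange K).mon l (fun v => 1 ⊗ₜ a v) = 1 ⊗ₜ P.mon l a := by
  induction l with
  | nil => simp [Algebra.TensorProduct.one_def]
  | cons p l ih =>
    rw [mon_cons, mon_cons, ih]
    simp [baseChange]

end BaseChange

lemma codim_eq_finrank_span_repr {F A G : Type*} [Field F] [Ring A] [Algebra F A] [Group G]
    (P : GradingProj F A G) {ι : Type*} [Finite ι] (b : Module.Basis ι F A) (n : ℕ) :
    P.codim n = Module.finrank F (Submodule.span F (Set.range
      fun (l : {l : List (ℕ × G) // (l.map Prod.fst).Perm (List.range n)})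
        (t : (Fin n → ι) × ι) => b.repr (P.mon l.1 (extendZero fun k => b (t.1 k))) t.2)) := by
  let e : ((Fin n → ι) → A) →ₗ[F] ((Fin n → ι) × ι → F) :=
    { toFun := fun f t => b.repr (f t.1) t.2
      map_add' := fun _ _ => by ext; simp
      map_smul' := fun _ _ => by ext; simp }
  have he : Function.Injective e := by
    intro f f' h
    ext t
    apply b.repr.injective
    ext j
    exact congrFun h (t, j)
  rw [P.codim_eq_evalBasis b,
    LinearEquiv.finrank_eq (Submodule.equivMapOfInjective e he _),
    multilin, Submodule.map_span, Submodule.map_span]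
  have hset : e '' (evalBasis b n '' {f | ∃ l : List (ℕ × G),
      (l.map Prod.fst).Perm (List.range n) ∧ f = P.mon l}) = Set.range
      fun (l : {l : List (ℕ × G) // (l.map Prod.fst).Perm (List.range n)})
        (t : (Fin n → ι) × ι) => b.repr (P.mon l.1 (extendZero fun k => b (t.1 k))) t.2 := ?_
  · rw [hset]
  ext w
  constructor
  · rintro ⟨_, ⟨_, ⟨l, hl, rfl⟩, rfl⟩, rfl⟩
    exact ⟨⟨l, hl⟩, rfl⟩
  · rintro ⟨⟨l, hl⟩, rfl⟩
    exact ⟨_, ⟨_, ⟨l, hl, rfl⟩, rfl⟩, rfl⟩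

open TensorProduct in
lemma codim_baseChange {F A G : Type*} [Field F] [Ring A] [Algebra F A] [Group G]
    (P : GradingProj F A G) (K : Type*) [Field K] [Algebra F K] [FiniteDimensional F A] (n : ℕ) :
    (P.baseChange K).codim n = P.codim n := by
  let b := Module.finBasis F A
  rw [P.codim_eq_finrank_span_repr b,
    (P.baseChange K).codim_eq_finrank_span_repr (b.baseChange K),
    ← finrank_span_algebraMap (F := F) (K := K)]
  refine congrArg (fun v : {l : List (ℕ × G) // (l.map Prod.fst).Perm (List.range n)} →
    (Fin n → _) × _ → K => Module.finrank K (Submodule.span K (Set.range v))) ?_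
  funext l t
  have : (extendZero fun k => (b.baseChange K) (t.1 k)) =
      fun v => (1 : K) ⊗ₜ[F] (extendZero fun k => b (t.1 k)) v := by
    ext v
    by_cases hv : v < n <;> simp [extendZero, hv]
  rw [this, baseChange_mon]
  simp [Module.Basis.baseChange_repr_tmul, Algebra.algebraMap_eq_smul_one]

section OfInternal

variable {F A G : Type*} [Field F] [Ring A] [Algebra F A] [Group G] [DecidableEq G]

/-- The projections of an internal direct sum grading of a finite-dimensional algebra. -/
noncomputable def ofInternal [FiniteDimensional F A] (𝒜 : G → Submodule F A)
    (hmul : ∀ g h : G, ∀ a ∈ 𝒜 g, ∀ b ∈ 𝒜 h, a * b ∈ 𝒜 (g * h))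
    (hdecomp : DirectSum.IsInternal 𝒜) : GradingProj F A G :=
  letI := hdecomp.chooseDecomposition
  have hmem : ∀ g a, (𝒜 g).subtype (DirectSum.component F G (fun i => 𝒜 i) g
      (DirectSum.decomposeLinearEquiv 𝒜 a)) ∈ 𝒜 g := fun g a => Submodule.coe_mem _
  have hsame : ∀ g, ∀ a ∈ 𝒜 g, (𝒜 g).subtype (DirectSum.component F G (fun i => 𝒜 i) g
      (DirectSum.decomposeLinearEquiv 𝒜 a)) = a := fun g a ha =>
    DirectSum.decompose_of_mem_same 𝒜 ha
  have hfin : {g | 𝒜 g ≠ ⊥}.Finite :=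
    WellFoundedGT.finite_ne_bot_of_iSupIndep hdecomp.submodule_iSupIndep
  have hzero : ∀ g, g ∉ hfin.toFinset → (𝒜 g).subtype ∘ₗ DirectSum.component F G (fun i => 𝒜 i) g ∘ₗ
      (DirectSum.decomposeLinearEquiv 𝒜).toLinearMap = 0 := fun g hg => by
    have hg : 𝒜 g = ⊥ := by simpa using hg
    ext a
    have h0 : ∀ x ∈ 𝒜 g, x = 0 := fun x hx => by rwa [hg, Submodule.mem_bot] at hx
    exact h0 _ (hmem g a)
  { proj := fun g => (𝒜 g).subtype ∘ₗ DirectSum.component F G (fun i => 𝒜 i) g ∘ₗ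
      (DirectSum.decomposeLinearEquiv 𝒜).toLinearMap
    supp := hfin.toFinset
    proj_proj_same := fun g a => hsame g _ (hmem g a)
    proj_proj_ne := fun g h a hgh => DirectSum.decompose_of_mem_ne 𝒜 (hmem h a) hgh.symm
    sum_proj := fun a => by
      classical
      refine Eq.trans ?_ (DirectSum.sum_support_decompose 𝒜 a)
      symm
      apply Finset.sum_subset
      · intro g hg
        by_contra hg'
        have := congrArg (fun φ : A →ₗ[F] A => φ a) (hzero g hg')
        simp only [DFinsupp.mem_support_iff, ne_eq] at hg
        exact hg (Subtype.ext this)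
      · intro g _ hg
        simp only [DFinsupp.mem_support_iff, ne_eq, not_not] at hg
        rw [hg]; rfl
    proj_eq_zero := hzero
    proj_mul_self := fun g h a b => hsame _ _ (hmul _ _ _ (hmem g a) _ (hmem h b)) }

lemma ofInternal_proj_mem [FiniteDimensional F A] (𝒜 : G → Submodule F A)
    (hmul : ∀ g h : G, ∀ a ∈ 𝒜 g, ∀ b ∈ 𝒜 h, a * b ∈ 𝒜 (g * h))
    (hdecomp : DirectSum.IsInternal 𝒜) (g : G) (a : A) :
    (ofInternal 𝒜 hmul hdecomp).proj g a ∈ 𝒜 g :=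
  letI := hdecomp.chooseDecomposition
  Submodule.coe_mem _

lemma ofInternal_proj_of_mem [FiniteDimensional F A] (𝒜 : G → Submodule F A)
    (hmul : ∀ g h : G, ∀ a ∈ 𝒜 g, ∀ b ∈ 𝒜 h, a * b ∈ 𝒜 (g * h))
    (hdecomp : DirectSum.IsInternal 𝒜) (g : G) (a : A) (ha : a ∈ 𝒜 g) :
    (ofInternal 𝒜 hmul hdecomp).proj g a = a :=
  letI := hdecomp.chooseDecomposition
  DirectSum.decompose_of_mem_same 𝒜 ha

lemma gradedCodim_eq [FiniteDimensional F A] (𝒜 : G → Submodule F A)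
    (hmul : ∀ g h : G, ∀ a ∈ 𝒜 g, ∀ b ∈ 𝒜 h, a * b ∈ 𝒜 (g * h))
    (hdecomp : DirectSum.IsInternal 𝒜) (n : ℕ) :
    gradedCodim F 𝒜 n = (ofInternal 𝒜 hmul hdecomp).codim n := by
  set P := ofInternal 𝒜 hmul hdecomp with hP
  let Θ : FreeAlgebra F (ℕ × G) →ₐ[F] ((ℕ → A) → A) :=
    FreeAlgebra.lift F fun p a => P.proj p.2 (a p.1)
  have hΘ : ∀ (a : ℕ → A) f, Θ f a = FreeAlgebra.lift F (fun p => P.proj p.2 (a p.1)) f := by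
    intro a f
    have : (Pi.evalAlgHom F _ a).comp Θ = FreeAlgebra.lift F (fun p => P.proj p.2 (a p.1)) := by
      ext p
      simp [Θ]
    exact congrArg (fun φ : FreeAlgebra F (ℕ × G) →ₐ[F] A => φ f) this
  have hker : gradedIdentities F 𝒜 = LinearMap.ker Θ.toLinearMap := by
    ext f
    rw [LinearMap.mem_ker]
    constructor
    · intro hf
      ext a
      change Θ f a = 0
      rw [hΘ]
      exact hf _ fun i g => by
        rw [FreeAlgebra.lift_ι_apply]
        exact ofInternal_proj_mem 𝒜 hmul hdecomp g _
    · intro hf φ hφ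
      let a : ℕ → A := fun i => ∑ g ∈ P.supp, φ (FreeAlgebra.ι F (i, g))
      have hproj : ∀ i g, P.proj g (a i) = φ (FreeAlgebra.ι F (i, g)) := by
        intro i g
        have h1 : ∀ g, P.proj g (φ (FreeAlgebra.ι F (i, g))) = φ (FreeAlgebra.ι F (i, g)) :=
          fun g => ofInternal_proj_of_mem 𝒜 hmul hdecomp g _ (hφ i g)
        by_cases hg : g ∈ P.supp
        · rw [map_sum, Finset.sum_eq_single_of_mem g hg, h1]
          intro h _ hh
          rw [← h1, P.proj_proj_ne _ _ _ hh.symm]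
        · rw [← h1, P.proj_eq_zero g hg]
          rfl
      have : φ = FreeAlgebra.lift F (fun p => P.proj p.2 (a p.1)) := by
        ext p
        simp [hproj]
      have h2 : Θ f a = 0 := congrFun hf a
      rw [this, ← hΘ, h2]
  have hmap : (multilinearGradedPolys F G n).map Θ.toLinearMap = P.multilin n := by
    rw [multilinearGradedPolys, multilin, Submodule.map_span]
    congr 1
    have hmon : ∀ (σ : Equiv.Perm (Fin n)) (g : Fin n → G),
        Θ (List.ofFn fun k => FreeAlgebra.ι F (((σ k : Fin n) : ℕ), g k)).prod =
          P.mon (List.ofFn fun k => (((σ k : Fin n) : ℕ), g k)) := by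
      intro σ g
      ext a
      rw [hΘ, map_list_prod, List.map_ofFn, mon, List.map_ofFn]
      congr 2
      ext k
      simp
    ext w
    constructor
    · rintro ⟨_, ⟨σ, g, rfl⟩, rfl⟩
      exact ⟨_, (perm_range_iff _).2 ⟨σ, g, rfl⟩, hmon σ g⟩
    · rintro ⟨l, hl, rfl⟩
      obtain ⟨σ, g, rfl⟩ := (perm_range_iff l).1 hl
      exact ⟨_, ⟨σ, g, rfl⟩, hmon σ g⟩
  have h1 : Submodule.comap (multilinearGradedPolys F G n).subtype (gradedIdentities F 𝒜) =
      LinearMap.ker (Θ.toLinearMap.domRestrict (multilinearGradedPolys F G n)) := by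
    rw [hker]; rfl
  rw [gradedCodim, h1, codim, ← hmap, ← LinearMap.range_domRestrict]
  exact (LinearMap.quotKerEquivRange _).finrank_eq

end OfInternal

end GradingProj

/-- A two-sided ideal all of whose elements are nilpotent is nilpotent, over an Artinian ring. -/
lemma Ideal.isNilpotent_of_forall_isNilpotent {A : Type*} [Ring A] [IsArtinianRing A]
    (I : Ideal A) (h : ∀ a ∈ I, IsNilpotent a) : IsNilpotent I := by
  have hle : I ≤ Ideal.jacobson ⊥ := by
    intro x hx
    rw [Ideal.mem_jacobson_iff]
    intro y
    have hu : IsUnit (y * x + 1) := (h _ (I.mul_mem_left y hx)).isUnit_add_one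
    obtain ⟨u, hu⟩ := hu
    refine ⟨↑u⁻¹, ?_⟩
    have : (↑u⁻¹ : A) * (y * x + 1) = 1 := by rw [← hu]; simp
    rw [Submodule.mem_bot, mul_assoc, ← this]
    noncomm_ring
  obtain ⟨n, hn⟩ := IsArtinianRing.isNilpotent_jacobson_bot (R := A)
  refine ⟨n, ?_⟩
  rw [Ideal.zero_eq_bot, eq_bot_iff] at hn ⊢
  exact (Ideal.pow_right_mono hle n).trans hn

lemma exists_isIdempotentElem_of_finiteDimensional {K A : Type*} [Field K] [Ring A] [Algebra K A]
    [FiniteDimensional K A] (a : A) :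
    ∃ (n : ℕ) (y : A), IsIdempotentElem (a * y) ∧ a ^ n * (a * y) = a ^ n := by
  have : IsMulCommutative (Algebra.adjoin K {a}) := Algebra.isMulCommutative_adjoin K (by simp)
  have : IsArtinianRing (Algebra.adjoin K {a}) := IsArtinianRing.of_finite K _
  let r : Algebra.adjoin K {a} := ⟨a, Algebra.self_mem_adjoin_singleton K a⟩
  obtain ⟨n, y, hy⟩ := IsArtinian.exists_pow_succ_smul_dvd r (1 : Algebra.adjoin K {a})
  simp only [smul_eq_mul, mul_one, Nat.succ_eq_add_one] at hy
  have h1 : r ^ n * (r * y) = r ^ n := by linear_combination hy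
  have h2 : ∀ k, r ^ n * (r * y) ^ k = r ^ n := by
    intro k
    induction k with
    | zero => simp
    | succ k ih => rw [pow_succ, ← mul_assoc, ih, h1]
  let z : Algebra.adjoin K {a} := r ^ n * y ^ (n + 1)
  have h3 : r * z = (r * y) ^ (n + 1) := by simp only [z]; ring
  refine ⟨n, z, ?_, ?_⟩
  · have : (r * z) * (r * z) = r * z := by
      have h4 : (r * y) ^ (n + 1) * (r * y) ^ (n + 1) =
          r * y ^ (n + 1) * (r ^ n * (r * y) ^ (n + 1)) := by ring
      rw [h3, h4, h2]; ring
    exact congrArg Subtype.val this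
  · have : r ^ n * (r * z) = r ^ n := by rw [h3, h2]
    exact congrArg Subtype.val this

namespace GradingProj

variable {K A G : Type*} [Field K] [Ring A] [Algebra K A] [Group G] (P : GradingProj K A G)

lemma proj_mul_proj_of_ne {g h k : G} (hk : k ≠ g * h) (a b : A) :
    P.proj k (P.proj g a * P.proj h b) = 0 := by
  rw [← P.proj_mul_self, P.proj_proj_ne _ _ _ hk]

lemma proj_proj_mul (g k : G) (a x : A) :
    P.proj k (P.proj g a * x) = P.proj g a * P.proj (g⁻¹ * k) x := by
  classical
  conv_lhs => rw [← P.sum_proj x, Finset.mul_sum, map_sum]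
  by_cases hg : g⁻¹ * k ∈ P.supp
  · rw [Finset.sum_eq_single_of_mem _ hg]
    · have := P.proj_mul_self g (g⁻¹ * k) a x
      rwa [mul_inv_cancel_left] at this
    · intro h _ hh
      exact P.proj_mul_proj_of_ne (fun e => hh (by rw [e]; group)) _ _
  · rw [P.proj_eq_zero _ hg]
    simp only [LinearMap.zero_apply, mul_zero]
    refine Finset.sum_eq_zero fun h hh => P.proj_mul_proj_of_ne (fun e => hg ?_) _ _
    rw [e]; simpa using hh

lemma proj_mul_proj (h k : G) (a x : A) :
    P.proj k (a * P.proj h x) = P.proj (k * h⁻¹) a * P.proj h x := by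
  classical
  conv_lhs => rw [← P.sum_proj a, Finset.sum_mul, map_sum]
  by_cases hg : k * h⁻¹ ∈ P.supp
  · rw [Finset.sum_eq_single_of_mem _ hg]
    · have := P.proj_mul_self (k * h⁻¹) h a x
      rwa [inv_mul_cancel_right] at this
    · intro g _ hg
      exact P.proj_mul_proj_of_ne (fun e => hg (by rw [e]; group)) _ _
  · rw [P.proj_eq_zero _ hg]
    simp only [LinearMap.zero_apply, zero_mul]
    refine Finset.sum_eq_zero fun g hgs => P.proj_mul_proj_of_ne (fun e => hg ?_) _ _
    rw [e]; simpa using hgs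

lemma proj_one_one : P.proj 1 (1 : A) = 1 := by
  have h : ∀ a, P.proj 1 1 * a = a := by
    intro a
    rw [← P.sum_proj a, Finset.mul_sum]
    refine Finset.sum_congr rfl fun g _ => ?_
    have := P.proj_mul_proj g g 1 a
    rw [mul_inv_cancel, one_mul, P.proj_proj_same] at this
    exact this.symm
  simpa using h 1

lemma proj_one_mul {a : A} (ha : P.proj 1 a = a) (g : G) (x : A) :
    P.proj g (a * x) = a * P.proj g x := by
  have := P.proj_proj_mul 1 g a x
  rwa [ha, inv_one, one_mul] at this

/-- The subalgebra of operators generated by the multiplications and the homogeneous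
projections. -/
def opSubalgebra : Subalgebra K (Module.End K A) :=
  Algebra.adjoin K (Set.range (LinearMap.mulLeft K) ∪ Set.range (LinearMap.mulRight K) ∪
    Set.range P.proj)

/-- The algebra of operators generated by the multiplications and the homogeneous projections;
its invariant subspaces are the graded two-sided ideals. -/
def opAlg : Type _ := P.opSubalgebra

instance : Ring P.opAlg := inferInstanceAs (Ring P.opSubalgebra)

instance : Algebra K P.opAlg := inferInstanceAs (Algebra K P.opSubalgebra)

instance : Module P.opAlg A := inferInstanceAs (Module P.opSubalgebra A)

instance : IsScalarTower K P.opAlg A := inferInstanceAs (IsScalarTower K P.opSubalgebra A)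

/-- Left multiplication as an operator. -/
def opL (c : A) : P.opAlg :=
  ⟨LinearMap.mulLeft K c, Algebra.subset_adjoin (Or.inl (Or.inl ⟨c, rfl⟩))⟩

/-- Right multiplication as an operator. -/
def opR (c : A) : P.opAlg :=
  ⟨LinearMap.mulRight K c, Algebra.subset_adjoin (Or.inl (Or.inr ⟨c, rfl⟩))⟩

/-- The homogeneous projection as an operator. -/
def opP (g : G) : P.opAlg := ⟨P.proj g, Algebra.subset_adjoin (Or.inr ⟨g, rfl⟩)⟩

@[simp] lemma opL_smul (c a : A) : P.opL c • a = c * a := rfl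

@[simp] lemma opR_smul (c a : A) : P.opR c • a = a * c := rfl

@[simp] lemma opP_smul (g : G) (a : A) : P.opP g • a = P.proj g a := rfl

lemma opAlg_ext {S T : P.opAlg} (h : ∀ a : A, S • a = T • a) : S = T :=
  Subtype.ext (LinearMap.ext (R := K) h)

lemma opAlg_induction {p : P.opAlg → Prop} (hL : ∀ c, p (P.opL c)) (hR : ∀ c, p (P.opR c))
    (hP : ∀ g, p (P.opP g)) (hadd : ∀ S T, p S → p T → p (S + T))
    (hmul : ∀ S T, p S → p T → p (S * T)) (T : P.opAlg) : p T := by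
  obtain ⟨T, hT⟩ := T
  induction hT using Algebra.adjoin_induction with
  | mem x hx =>
    rcases hx with (⟨c, rfl⟩ | ⟨c, rfl⟩) | ⟨g, rfl⟩
    exacts [hL c, hR c, hP g]
  | algebraMap r =>
    have : P.opL (algebraMap K A r) = (⟨_, Subalgebra.algebraMap_mem _ r⟩ : P.opSubalgebra) :=
      P.opAlg_ext fun a => (Algebra.smul_def r a).symm
    exact this ▸ hL (algebraMap K A r)
  | add x y hx hy h1 h2 => exact hadd _ _ h1 h2
  | mul x y hx hy h1 h2 => exact hmul _ _ h1 h2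

lemma opL_mul (a b : A) : P.opL (a * b) = P.opL a * P.opL b :=
  P.opAlg_ext fun x => by simp [mul_smul, mul_assoc]

lemma opL_add (a b : A) : P.opL (a + b) = P.opL a + P.opL b :=
  P.opAlg_ext fun x => by simp [add_smul, add_mul]

lemma opL_smul' (c : K) (a : A) : P.opL (c • a) = c • P.opL a :=
  P.opAlg_ext fun x => by simp

lemma opL_one : P.opL 1 = 1 := P.opAlg_ext fun x => by simp

/-- `x` acts on a module as left multiplication. -/
def opLₗ : A →ₗ[K] P.opAlg where
  toFun := P.opL
  map_add' := P.opL_add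
  map_smul' := P.opL_smul'

section Trace

variable (V : Type*) [AddCommGroup V] [Module K V] [Module P.opAlg V] [IsScalarTower K P.opAlg V]

/-- The trace of left multiplication by an element on a module over the operator algebra. -/
noncomputable def tr : A →ₗ[K] K :=
  LinearMap.trace K V ∘ₗ (Algebra.lsmul K K V).toLinearMap ∘ₗ P.opLₗ

lemma tr_apply (a : A) : P.tr V a = LinearMap.trace K V (Algebra.lsmul K K V (P.opL a)) := rfl

lemma tr_mul_comm (a b : A) : P.tr V (a * b) = P.tr V (b * a) := by
  rw [tr_apply, tr_apply, opL_mul, opL_mul, map_mul (Algebra.lsmul K K V),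
    map_mul (Algebra.lsmul K K V), LinearMap.trace_mul_comm]

lemma tr_proj_of_ne {g : G} (hg : g ≠ 1) (a : A) : P.tr V (P.proj g a) = 0 := by
  have hsum : P.opL (P.proj g a) = ∑ h ∈ P.supp, P.opL (P.proj g a) * (P.opP h * P.opP h) := by
    refine P.opAlg_ext fun x => ?_
    rw [Finset.sum_smul]
    simp only [mul_smul, opL_smul, opP_smul, P.proj_proj_same, ← Finset.mul_sum, P.sum_proj]
  rw [tr_apply, hsum, map_sum, map_sum]
  refine Finset.sum_eq_zero fun h _ => ?_
  rw [← mul_assoc, map_mul (Algebra.lsmul K K V), LinearMap.trace_mul_comm, ← map_mul]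
  have : P.opP h * (P.opL (P.proj g a) * P.opP h) = 0 := by
    refine P.opAlg_ext fun x => ?_
    simp only [mul_smul, opL_smul, opP_smul, P.proj_proj_mul]
    rw [P.proj_proj_ne]
    · simp
    · intro e
      apply hg
      have : g⁻¹ = 1 := by simpa using e
      simpa using this
  rw [this]
  simp

lemma tr_proj_mul (g : G) (a b : A) : P.tr V (P.proj g a * b) = P.tr V (a * P.proj g⁻¹ b) := by
  have h1 : ∀ x, P.tr V x = P.tr V (P.proj 1 x) := by
    classical
    intro x
    conv_lhs => rw [← P.sum_proj x, map_sum]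
    by_cases h1 : (1 : G) ∈ P.supp
    · rw [Finset.sum_eq_single_of_mem _ h1]
      intro h _ hh
      exact P.tr_proj_of_ne V hh x
    · rw [P.proj_eq_zero _ h1, LinearMap.zero_apply, map_zero]
      refine Finset.sum_eq_zero fun h hh => P.tr_proj_of_ne V ?_ x
      rintro rfl
      exact h1 hh
  rw [h1, P.proj_proj_mul, h1 (a * _), P.proj_mul_proj]
  simp

/-- The orthogonal complement of a graded ideal with respect to a trace form. -/
def perp (N : Submodule P.opAlg A) : Submodule P.opAlg A where
  carrier := {a | ∀ b ∈ N, P.tr V (a * b) = 0}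
  add_mem' := fun {a a'} ha ha' b hb => by rw [add_mul, map_add, ha b hb, ha' b hb, add_zero]
  zero_mem' := fun b _ => by simp
  smul_mem' := fun T => by
    refine P.opAlg_induction (p := fun T => ∀ {x : A}, (∀ b ∈ N, P.tr V (x * b) = 0) →
      ∀ b ∈ N, P.tr V ((T • x) * b) = 0) ?_ ?_ ?_ ?_ ?_ T
    · intro c x hx b hb
      rw [opL_smul, mul_assoc, tr_mul_comm, mul_assoc]
      exact hx _ (N.smul_mem (P.opR c) hb)
    · intro c x hx b hb
      rw [opR_smul, mul_assoc]
      exact hx _ (N.smul_mem (P.opL c) hb)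
    · intro g x hx b hb
      rw [opP_smul, tr_proj_mul]
      exact hx _ (N.smul_mem (P.opP g⁻¹) hb)
    · intro S T hS hT x hx b hb
      rw [add_smul, add_mul, map_add, hS hx b hb, hT hx b hb, add_zero]
    · intro S T hS hT x hx b hb
      rw [mul_smul]
      exact hS (fun b hb => hT hx b hb) b hb

lemma mem_perp {N : Submodule P.opAlg A} {a : A} :
    a ∈ P.perp V N ↔ ∀ b ∈ N, P.tr V (a * b) = 0 := Iff.rfl

lemma tr_eq_zero_of_isNilpotent {a : A} (ha : IsNilpotent a) : P.tr V a = 0 := by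
  have h1 : IsNilpotent (Algebra.lsmul K K V (P.opL a)) := by
    obtain ⟨n, hn⟩ := ha
    refine ⟨n, ?_⟩
    have : P.opL a ^ n = P.opL (a ^ n) := by
      clear hn
      induction n with
      | zero => simp [opL_one]
      | succ n ih => rw [pow_succ, pow_succ, ih, opL_mul]
    rw [← map_pow, this, hn]
    have : P.opL 0 = 0 := P.opAlg_ext fun x => by simp
    simp [this]
  exact (LinearMap.isNilpotent_trace_of_isNilpotent h1).eq_zero

lemma smul_eq_zero_of_tr_eq_zero [CharZero K] [FiniteDimensional K V] {e : A}
    (he : IsIdempotentElem e) (h : P.tr V e = 0) (v : V) : P.opL e • v = 0 := by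
  have h1 : IsIdempotentElem (Algebra.lsmul K K V (P.opL e)) := by
    rw [IsIdempotentElem, ← map_mul, ← opL_mul, he.eq]
  have := LinearMap.IsIdempotentElem.eq_zero_of_trace_eq_zero h1 h
  exact congrArg (fun f : V →ₗ[K] V => f v) this

end Trace

end GradingProj

namespace GradingProj

variable {K A G : Type*} [Field K] [Ring A] [Algebra K A] [Group G] (P : GradingProj K A G)

/-- The radical of the trace form of the algebra. -/
noncomputable def rad : Submodule P.opAlg A := P.perp A ⊤

lemma mul_mem_of_mem_right (N : Submodule P.opAlg A) (c : A) {a : A} (ha : a ∈ N) : c * a ∈ N :=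
  N.smul_mem (P.opL c) ha

lemma mul_mem_of_mem_left (N : Submodule P.opAlg A) (c : A) {a : A} (ha : a ∈ N) : a * c ∈ N :=
  N.smul_mem (P.opR c) ha

lemma proj_mem_of_mem (N : Submodule P.opAlg A) (g : G) {a : A} (ha : a ∈ N) : P.proj g a ∈ N :=
  N.smul_mem (P.opP g) ha

/-- The radical of the trace form as an ideal. -/
noncomputable def radIdeal : Ideal A where
  carrier := P.rad
  add_mem' := P.rad.add_mem
  zero_mem' := P.rad.zero_mem
  smul_mem' c _ hx := P.mul_mem_of_mem_right P.rad c hx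

instance : P.radIdeal.IsTwoSided := ⟨fun c h => P.mul_mem_of_mem_left P.rad c h⟩

lemma sup_perp_eq_top [FiniteDimensional K A] (N : Submodule P.opAlg A)
    (hN : N ⊓ P.perp A N ≤ P.rad) (hle : P.rad ≤ N) : N ⊔ P.perp A N = ⊤ := by
  let B : LinearMap.BilinForm K A := (LinearMap.mul K A).compr₂ (P.tr A)
  have hB : ∀ a b, B a b = P.tr A (a * b) := fun _ _ => rfl
  have hrefl : B.IsRefl := by
    intro a b h
    rw [hB] at h ⊢
    rw [tr_mul_comm, h]
  have horth : ∀ N : Submodule P.opAlg A,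
      B.orthogonal (N.restrictScalars K) = (P.perp A N).restrictScalars K := by
    intro N
    ext a
    simp only [LinearMap.BilinForm.mem_orthogonal_iff, Submodule.restrictScalars_mem, mem_perp,
      hB]
    exact forall₂_congr fun b _ => by rw [tr_mul_comm]
  have h1 := LinearMap.BilinForm.finrank_add_finrank_orthogonal hrefl (N.restrictScalars K)
  have h2 : B.orthogonal ⊤ = P.rad.restrictScalars K := by
    have := horth ⊤
    rwa [Submodule.restrictScalars_top] at this
  rw [horth, h2] at h1
  have h3 := Submodule.finrank_sup_add_finrank_inf_eq (N.restrictScalars K)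
    ((P.perp A N).restrictScalars K)
  have h4 : N.restrictScalars K ⊓ P.rad.restrictScalars K = P.rad.restrictScalars K :=
    inf_eq_right.2 fun x hx => hle hx
  have h5 : N.restrictScalars K ⊓ (P.perp A N).restrictScalars K = P.rad.restrictScalars K := by
    apply le_antisymm
    · exact fun x hx => hN hx
    · exact fun x hx => ⟨hle hx, fun b _ => hx b trivial⟩
  rw [h4] at h1
  rw [h5] at h3
  have h6 : N.restrictScalars K ⊔ (P.perp A N).restrictScalars K = ⊤ :=
    Submodule.eq_top_of_finrank_eq (by omega)
  rw [eq_top_iff]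
  intro x _
  have hx : x ∈ N.restrictScalars K ⊔ (P.perp A N).restrictScalars K := h6 ▸ trivial
  obtain ⟨y, hy, z, hz, rfl⟩ := Submodule.mem_sup.1 hx
  exact Submodule.add_mem_sup hy hz

variable [FiniteDimensional K A] [CharZero K]

lemma isNilpotent_of_mem_rad {a : A} (ha : a ∈ P.rad) : IsNilpotent a := by
  obtain ⟨n, y, he, h⟩ := exists_isIdempotentElem_of_finiteDimensional (K := K) a
  have h1 : P.tr A (a * y) = 0 := ha y trivial
  have h2 := P.smul_eq_zero_of_tr_eq_zero A he h1 1
  rw [opL_smul, mul_one] at h2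
  exact ⟨n, by rw [← h, h2, mul_zero]⟩

lemma isNilpotent_radIdeal : IsNilpotent P.radIdeal := by
  have : IsArtinianRing A := IsArtinianRing.of_finite K A
  exact P.radIdeal.isNilpotent_of_forall_isNilpotent fun a ha => P.isNilpotent_of_mem_rad ha

lemma inf_perp_le_rad (N : Submodule P.opAlg A) : N ⊓ P.perp A N ≤ P.rad := by
  intro r hr b _
  have hs : r * b ∈ N ⊓ P.perp A N := P.mul_mem_of_mem_left _ b hr
  have hsq : (r * b) * (r * b) ∈ P.rad := by
    intro c _
    rw [mul_assoc]
    exact hs.2 _ (P.mul_mem_of_mem_left _ c hs.1)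
  have hnil : IsNilpotent (r * b) := by
    obtain ⟨n, hn⟩ := P.isNilpotent_of_mem_rad hsq
    exact ⟨2 * n, by rw [pow_mul, pow_two, hn]⟩
  exact P.tr_eq_zero_of_isNilpotent A hnil

instance : IsSemisimpleModule P.opAlg (A ⧸ P.rad) := by
  have : ComplementedLattice (Set.Ici P.rad) := by
    refine ⟨fun ⟨N, hN⟩ => ⟨⟨P.perp A N, fun a ha b _ => ha b trivial⟩, ?_⟩⟩
    have h := P.inf_perp_le_rad N
    refine IsCompl.of_le ?_ ?_
    · exact h
    · exact (P.sup_perp_eq_top N h hN).ge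
  have := (Submodule.comapMkQRelIso P.rad).symm.complementedLattice
  exact ⟨⟩

/-- A decomposition of the algebra modulo its radical into graded-simple blocks, with a lift of
the identity element of every block to an idempotent. -/
structure Frame where
  /-- The number of blocks. -/
  n : ℕ
  /-- The maximal graded ideals. -/
  N : Fin n → Submodule P.opAlg A
  /-- The idempotents. -/
  e : Fin n → A
  mem_rad : ∀ a, (∀ i, a ∈ N i) → a ∈ P.rad
  rad_le : ∀ i, P.rad ≤ N i
  idem : ∀ i, e i * e i = e i
  proj_e : ∀ i, P.proj 1 (e i) = e i
  e_mem : ∀ i j, i ≠ j → e i ∈ N j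
  one_sub_e_mem : ∀ i, 1 - e i ∈ N i
  simple : ∀ i, IsSimpleModule P.opAlg (A ⧸ N i)

lemma exists_idempotent_lift {a : A} (h1 : P.proj 1 a = a) (h : a * a - a ∈ P.rad) :
    ∃ e, e * e = e ∧ P.proj 1 e = e ∧ e - a ∈ P.rad := by
  let B : Subring A :=
    { carrier := {x | P.proj 1 x = x}
      mul_mem' := fun {x y} hx hy => by
        have hx : P.proj 1 x = x := hx
        have hy : P.proj 1 y = y := hy
        change P.proj 1 (x * y) = x * y
        rw [P.proj_one_mul hx, hy]
      one_mem' := P.proj_one_one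
      add_mem' := fun {x y} hx hy => by
        have hx : P.proj 1 x = x := hx
        have hy : P.proj 1 y = y := hy
        change P.proj 1 (x + y) = x + y
        rw [map_add, hx, hy]
      zero_mem' := map_zero _
      neg_mem' := fun {x} hx => by
        have hx : P.proj 1 x = x := hx
        change P.proj 1 (-x) = -x
        rw [map_neg, hx] }
  let f : B →+* A ⧸ P.radIdeal := (Ideal.Quotient.mk P.radIdeal).comp B.subtype
  have hf : ∀ x y : B, f x = f y ↔ (x : A) - y ∈ P.rad := fun x y =>
    Ideal.Quotient.mk_eq_mk_iff_sub_mem _ _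
  have hker : ∀ x ∈ RingHom.ker f, IsNilpotent x := by
    intro x hx
    rw [RingHom.mem_ker, ← map_zero f, hf] at hx
    obtain ⟨n, hn⟩ := P.isNilpotent_of_mem_rad hx
    exact ⟨n, Subtype.ext (by simpa using hn)⟩
  have hidem : IsIdempotentElem (f ⟨a, h1⟩) := by
    rw [IsIdempotentElem, ← map_mul, hf]
    exact h
  obtain ⟨e, he, he'⟩ := exists_isIdempotentElem_eq_of_ker_isNilpotent f hker _ ⟨_, rfl⟩ hidem
  exact ⟨e, congrArg Subtype.val he, e.2, (hf _ _).1 he'⟩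

theorem nonempty_frame : Nonempty P.Frame := by
  have : Module.Finite P.opAlg A := Module.Finite.of_restrictScalars_finite K P.opAlg A
  obtain ⟨n, S, φ, hS⟩ := IsSemisimpleModule.exists_linearEquiv_fin_dfinsupp P.opAlg (A ⧸ P.rad)
  let f : ∀ i, A →ₗ[P.opAlg] S i := fun i => DFinsupp.lapply i ∘ₗ φ.toLinearMap ∘ₗ P.rad.mkQ
  have hf0 : ∀ a, (∀ i, f i a = 0) ↔ a ∈ P.rad := by
    intro a
    have h1 : (∀ i, f i a = 0) ↔ φ (P.rad.mkQ a) = 0 :=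
      ⟨fun h => DFinsupp.ext h, fun h i => by
        change φ (P.rad.mkQ a) i = 0
        rw [h]; rfl⟩
    rw [h1, LinearEquiv.map_eq_zero_iff, Submodule.mkQ_apply, Submodule.Quotient.mk_eq_zero]
  have hfs : ∀ i (s : S i), ∃ a, f i a = s ∧ ∀ j, j ≠ i → f j a = 0 := by
    intro i s
    obtain ⟨a, ha⟩ := P.rad.mkQ_surjective (φ.symm (DFinsupp.single i s))
    refine ⟨a, ?_, fun j hj => ?_⟩
    · change φ (P.rad.mkQ a) i = s
      rw [ha]; simp
    · change φ (P.rad.mkQ a) j = 0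
      rw [ha, LinearEquiv.apply_symm_apply, DFinsupp.single_eq_of_ne hj]
  have hex : ∀ i, ∃ e, e * e = e ∧ P.proj 1 e = e ∧ f i e = f i 1 ∧ ∀ j, j ≠ i → f j e = 0 := by
    intro i
    obtain ⟨a, hai, haj⟩ := hfs i (f i 1)
    have hP : ∀ j, f j (P.proj 1 a) = f j a := by
      intro j
      have h1 : ∀ x, f j (P.proj 1 x) = P.opP 1 • f j x := fun x => by rw [← map_smul]; rfl
      rw [h1]
      by_cases hj : j = i
      · subst hj
        rw [hai, ← h1, P.proj_one_one]
      · rw [haj j hj, smul_zero]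
    have hmul : ∀ j x, f j (P.proj 1 a * x) = P.opR x • f j a := by
      intro j x
      rw [← hP, ← map_smul]; rfl
    have hsq : P.proj 1 a * P.proj 1 a - P.proj 1 a ∈ P.rad := by
      rw [← hf0]
      intro j
      rw [map_sub, hmul]
      by_cases hj : j = i
      · subst hj
        rw [hai, ← map_smul, opR_smul, one_mul, sub_self]
      · rw [hP, haj j hj, smul_zero, sub_zero]
    obtain ⟨e, he, he1, hea⟩ := P.exists_idempotent_lift (P.proj_proj_same 1 a) hsq
    have hfe : ∀ j, f j e = f j a := by
      intro j
      have := (hf0 _).2 hea j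
      rw [map_sub, hP] at this
      exact sub_eq_zero.1 this
    exact ⟨e, he, he1, by rw [hfe, hai], fun j hj => by rw [hfe, haj j hj]⟩
  choose e he he1 hei hej using hex
  refine ⟨{
    n := n
    N := fun i => LinearMap.ker (f i)
    e := e
    mem_rad := fun a h => (hf0 a).1 h
    rad_le := fun i a ha => (hf0 a).2 ha i
    idem := he
    proj_e := he1
    e_mem := fun i j hij => hej i j hij.symm
    one_sub_e_mem := fun i => by rw [LinearMap.mem_ker, map_sub, hei, sub_self]
    simple := fun i => ?_ }⟩
  have hsurj : Function.Surjective (f i) := fun s => (hfs i s).imp fun a h => h.1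
  have := hS i
  exact IsSimpleModule.congr ((f i).quotKerEquivOfSurjective hsurj)

end GradingProj

/-- A linear map of rank `d` admits `d` vectors and `d` functionals in duality. -/
lemma LinearMap.exists_dual_families {K V W : Type*} [Field K] [AddCommGroup V] [Module K V]
    [FiniteDimensional K V] [AddCommGroup W] [Module K W] (B : V →ₗ[K] W) {d : ℕ}
    (hd : Module.finrank K (LinearMap.range B) = d) :
    ∃ (c : Fin d → V) (g : Fin d → Module.Dual K W),
      ∀ α β, g β (B (c α)) = if α = β then 1 else 0 := by
  let f : Module.Basis (Fin d) K (LinearMap.range B) := Module.finBasisOfFinrankEq K _ hd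
  choose c hc using fun α => (f α).2
  choose g hg using fun β => (f.coord β).exists_extend
  refine ⟨c, g, fun α β => ?_⟩
  have h := congrArg (fun l : LinearMap.range B →ₗ[K] K => l (f α)) (hg β)
  simp only [LinearMap.comp_apply, Submodule.subtype_apply] at h
  rw [hc, h, Module.Basis.coord_apply, Module.Basis.repr_self, Finsupp.single_apply]

namespace GradingProj

variable {K A G : Type*} [Field K] [Ring A] [Algebra K A] [Group G] {P : GradingProj K A G}

lemma tr_quotient_eq_zero (N : Submodule P.opAlg A) {z : A} (hz : z ∈ N) :
    P.tr (A ⧸ N) z = 0 := by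
  have h : ∀ v : A ⧸ N, P.opL z • v = 0 := by
    intro v
    obtain ⟨v, rfl⟩ := N.mkQ_surjective v
    rw [Submodule.mkQ_apply, ← Submodule.Quotient.mk_smul, Submodule.Quotient.mk_eq_zero]
    exact P.mul_mem_of_mem_left _ v hz
  have : Algebra.lsmul K K (A ⧸ N) (P.opL z) = 0 := LinearMap.ext h
  rw [tr_apply, this, map_zero]

instance [FiniteDimensional K A] (N : Submodule P.opAlg A) : FiniteDimensional K (A ⧸ N) :=
  Module.Finite.of_surjective (N.mkQ.restrictScalars K) N.mkQ_surjective

namespace Frame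

variable (Fr : P.Frame)

lemma one_notMem (i : Fin Fr.n) : (1 : A) ∉ Fr.N i := by
  intro h
  have := Fr.simple i
  have := IsSimpleModule.nontrivial P.opAlg (A ⧸ Fr.N i)
  obtain ⟨x, hx⟩ := exists_ne (0 : A ⧸ Fr.N i)
  obtain ⟨a, rfl⟩ := (Fr.N i).mkQ_surjective x
  refine hx ?_
  rw [Submodule.mkQ_apply, Submodule.Quotient.mk_eq_zero]
  simpa using P.mul_mem_of_mem_right _ a h

lemma e_notMem (i : Fin Fr.n) : Fr.e i ∉ Fr.N i := fun h =>
  Fr.one_notMem i (by simpa using (Fr.N i).add_mem (Fr.one_sub_e_mem i) h)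

/-- The intersection of the maximal graded ideals indexed by a set of blocks. -/
def block (I : Finset (Fin Fr.n)) : Submodule P.opAlg A := ⨅ i ∈ I, Fr.N i

lemma mem_block {I : Finset (Fin Fr.n)} {a : A} : a ∈ Fr.block I ↔ ∀ i ∈ I, a ∈ Fr.N i := by
  simp [block]

lemma sub_sum_mem_block (I : Finset (Fin Fr.n)) (x : A) :
    x - ∑ i ∈ I, Fr.e i * x ∈ Fr.block I := by
  classical
  refine Fr.mem_block.2 fun j hj => ?_
  rw [← Finset.add_sum_erase _ _ hj, ← sub_sub]
  refine (Fr.N j).sub_mem ?_ ((Fr.N j).sum_mem fun i hi => ?_)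
  · have := P.mul_mem_of_mem_left (Fr.N j) x (Fr.one_sub_e_mem j)
    rwa [sub_mul, one_mul] at this
  · exact P.mul_mem_of_mem_left _ _ (Fr.e_mem i j (Finset.ne_of_mem_erase hi))

lemma sub_sum_e_mul_mul_e_mem_rad (x : A) : x - ∑ i, Fr.e i * x * Fr.e i ∈ P.rad := by
  classical
  refine Fr.mem_rad _ fun j => ?_
  rw [← Finset.add_sum_erase _ _ (Finset.mem_univ j), ← sub_sub]
  refine (Fr.N j).sub_mem ?_ ((Fr.N j).sum_mem fun i hi => ?_)
  · have h1 := P.mul_mem_of_mem_left (Fr.N j) x (Fr.one_sub_e_mem j)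
    have h2 := P.mul_mem_of_mem_right (Fr.N j) (Fr.e j * x) (Fr.one_sub_e_mem j)
    convert (Fr.N j).add_mem h1 h2 using 1
    noncomm_ring
  · exact P.mul_mem_of_mem_right _ _ (Fr.e_mem i j (Finset.ne_of_mem_erase hi))

variable [FiniteDimensional K A]

/-- Density: a functional vanishing on a maximal graded ideal is realised, modulo the radical,
by an operator with values in the line of the corresponding idempotent. -/
lemma exists_op_of_functional [IsAlgClosed K] (i : Fin Fr.n) (φ : A →ₗ[K] K)
    (hφ : ∀ x ∈ Fr.N i, φ x = 0) :
    ∃ T : P.opAlg, ∀ x, T • x - φ x • Fr.e i ∈ P.rad := by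
  have := Fr.simple i
  let V := A ⧸ Fr.N i
  let φ' : V →ₗ[K] K := ((Fr.N i).restrictScalars K).liftQ φ hφ
  have hφ' : ∀ x : A, φ' (Submodule.Quotient.mk x) = φ x := fun x => rfl
  let f : Module.End (Module.End P.opAlg V) V :=
    { toFun := fun v => φ' v • Submodule.Quotient.mk (1 : A)
      map_add' := fun v w => by rw [map_add, add_smul]
      map_smul' := fun D v => by
        obtain ⟨c, rfl⟩ :=
          (IsSimpleModule.algebraMap_end_bijective_of_isAlgClosed (A := P.opAlg) (V := V) K).2 D
        rw [RingHom.id_apply, algebraMap_smul, algebraMap_smul, map_smul, smul_eq_mul, mul_smul] }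
  have : Module.Finite (Module.End P.opAlg V) V := Module.Finite.of_restrictScalars_finite K _ _
  obtain ⟨T, hT⟩ := Module.Finite.toModuleEnd_moduleEnd_surjective (R := P.opAlg) (M := V) f
  refine ⟨P.opL (Fr.e i) * T, fun x => ?_⟩
  have h1 : T • x - φ x • (1 : A) ∈ Fr.N i := by
    rw [← Submodule.Quotient.mk_eq_zero, Submodule.Quotient.mk_sub, sub_eq_zero]
    exact congrArg (fun g : Module.End (Module.End P.opAlg V) V => g (Submodule.Quotient.mk x)) hT
  have h2 : (P.opL (Fr.e i) * T) • x - φ x • Fr.e i = Fr.e i * (T • x - φ x • (1 : A)) := by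
    rw [mul_smul, opL_smul, mul_sub, mul_smul_comm (φ x), mul_one]
  rw [h2]
  refine Fr.mem_rad _ fun j => ?_
  by_cases hj : i = j
  · subst hj
    exact P.mul_mem_of_mem_right _ _ h1
  · exact P.mul_mem_of_mem_left _ _ (Fr.e_mem i j hj)

/-- The trace form of a union of blocks is nondegenerate modulo the corresponding ideal. -/
lemma mem_block_of_tr_eq_zero [CharZero K] (I : Finset (Fin Fr.n)) {a : A}
    (ha : ∀ b, P.tr (A ⧸ Fr.block I) (a * b) = 0) : a ∈ Fr.block I := by
  let R := P.perp (A ⧸ Fr.block I) ⊤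
  have haR : a ∈ R := fun b _ => ha b
  refine Fr.mem_block.2 fun i hi => ?_
  have hsimple := isSimpleModule_iff_isCoatom.1 (Fr.simple i)
  by_contra hai
  have htop : Fr.N i ⊔ R = ⊤ := hsimple.2 _ (lt_of_le_of_ne le_sup_left fun h => hai (by
    rw [h]; exact Submodule.mem_sup_right haR))
  obtain ⟨y, hy, r, hr, hyr⟩ := Submodule.mem_sup.1 (htop ▸ trivial : (1 : A) ∈ Fr.N i ⊔ R)
  have he : P.tr (A ⧸ Fr.block I) (Fr.e i) = 0 := by
    have h1 : Fr.e i = Fr.e i * y + Fr.e i * r := by rw [← mul_add, hyr, mul_one]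
    rw [h1, map_add, tr_quotient_eq_zero, zero_add]
    · exact (tr_mul_comm P _ (Fr.e i) r).trans (hr _ trivial)
    · refine Fr.mem_block.2 fun j _ => ?_
      by_cases hj : i = j
      · subst hj
        exact P.mul_mem_of_mem_right _ _ hy
      · exact P.mul_mem_of_mem_left _ _ (Fr.e_mem i j hj)
  have h2 := P.smul_eq_zero_of_tr_eq_zero _ (Fr.idem i) he (Submodule.Quotient.mk (1 : A))
  have h3 : Fr.e i * 1 ∈ Fr.block I := (Submodule.Quotient.mk_eq_zero _).1 h2
  rw [mul_one] at h3
  exact Fr.e_notMem i (Fr.mem_block.1 h3 i hi)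

/-- The dimension of a union of blocks. -/
noncomputable def dim (I : Finset (Fin Fr.n)) : ℕ := Module.finrank K (A ⧸ Fr.block I)

lemma exists_dual_families [CharZero K] (I : Finset (Fin Fr.n)) :
    ∃ c c' : Fin (Fr.dim I) → A, ∀ α β,
      P.tr (A ⧸ Fr.block I) (c α * c' β) = if α = β then 1 else 0 := by
  let B : A →ₗ[K] Module.Dual K A := (LinearMap.mul K A).compr₂ (P.tr (A ⧸ Fr.block I))
  have hker : LinearMap.ker B = (Fr.block I).restrictScalars K := by
    ext a
    rw [LinearMap.mem_ker, Submodule.restrictScalars_mem]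
    refine ⟨fun h => Fr.mem_block_of_tr_eq_zero I fun b => ?_, fun h => ?_⟩
    · exact congrArg (fun f : A →ₗ[K] K => f b) h
    · ext b
      exact tr_quotient_eq_zero _ (P.mul_mem_of_mem_left _ b h)
  have h1 := LinearMap.finrank_range_add_finrank_ker B
  have h2 := Submodule.finrank_quotient_add_finrank ((Fr.block I).restrictScalars K)
  rw [hker] at h1
  obtain ⟨c, g, hg⟩ := LinearMap.exists_dual_families (d := Fr.dim I) B
    (Nat.add_right_cancel (h1.trans h2.symm))
  refine ⟨c, fun β => (Module.evalEquiv K A).symm (g β), fun α β => ?_⟩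
  rw [← hg]
  exact Module.apply_evalEquiv_symm_apply K A (B (c α)) (g β)

end Frame

end GradingProj

lemma Ideal.list_prod_mem_pow {A S : Type*} [Ring A] (J : Ideal A) [J.IsTwoSided] (f : S → A)
    (w : S → ℕ) (l : List S) (h : ∀ x ∈ l, f x ∈ J ^ w x) :
    (l.map f).prod ∈ J ^ (l.map w).sum := by
  induction l with
  | nil => simp [Submodule.pow_zero]
  | cons x l ih =>
    rw [List.map_cons, List.map_cons, List.prod_cons, List.sum_cons, Ideal.IsTwoSided.pow_add]
    exact Ideal.mul_mem_mul (h x List.mem_cons_self) (ih fun y hy =>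
      h y (List.mem_cons_of_mem _ hy))

lemma card_filter_card_filter_lt_le {ι : Type*} [Fintype ι] [DecidableEq ι] (Y : Finset ι)
    (p n : ℕ) (hn : 0 < n) {d : ℕ} (hd : 0 < d) (hY : Y.card ≤ d) :
    ((Finset.univ.filter fun t : Fin n → ι =>
      (Finset.univ.filter fun k => t k ∉ Y).card < p).card : ℝ) ≤
      Real.exp (Fintype.card ι) * (n : ℝ) ^ p * (d : ℝ) ^ n := by
  have hn' : (1 : ℝ) ≤ n := by exact_mod_cast hn
  have hd' : (1 : ℝ) ≤ d := by exact_mod_cast hd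
  have hn0 : (0 : ℝ) < n := by linarith
  let w : ι → ℝ := fun α => if α ∉ Y then (n : ℝ)⁻¹ else 1
  have hw0 : ∀ α, 0 ≤ w α := fun α => by
    simp only [w]; split_ifs <;> positivity
  have hprod : ∀ t : Fin n → ι, ∏ k, w (t k) =
      ((n : ℝ)⁻¹) ^ (Finset.univ.filter fun k => t k ∉ Y).card := by
    intro t
    simp only [w]
    rw [Finset.prod_ite, Finset.prod_const, Finset.prod_const_one, mul_one]
  have hsum : ∑ α, w α ≤ d + Fintype.card ι / n := by
    simp only [w]
    rw [Finset.sum_ite, Finset.sum_const, Finset.sum_const, nsmul_eq_mul, nsmul_eq_mul, mul_one,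
      add_comm, div_eq_mul_inv]
    have h1 : (Finset.univ.filter fun α => ¬ α ∉ Y).card ≤ d := by
      simpa using hY
    have h2 : (Finset.univ.filter fun α => α ∉ Y).card ≤ Fintype.card ι := Finset.card_le_univ _
    gcongr
  have hpow : (∑ α, w α) ^ n ≤ (d : ℝ) ^ n * Real.exp (Fintype.card ι) := by
    have h3 : ∑ α, w α ≤ d * Real.exp (Fintype.card ι / n) := by
      have h4 := Real.add_one_le_exp ((Fintype.card ι : ℝ) / n)
      have h5 : (0 : ℝ) ≤ Fintype.card ι / n := by positivity
      nlinarith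
    calc (∑ α, w α) ^ n ≤ (d * Real.exp (Fintype.card ι / n)) ^ n :=
          pow_le_pow_left₀ (Finset.sum_nonneg fun α _ => hw0 α) h3 n
      _ = (d : ℝ) ^ n * Real.exp (Fintype.card ι) := by
          rw [mul_pow, ← Real.exp_nat_mul, mul_div_cancel₀ _ hn0.ne']
  rw [Fintype.sum_pow] at hpow
  have hle : ((Finset.univ.filter fun t : Fin n → ι =>
      (Finset.univ.filter fun k => t k ∉ Y).card < p).card : ℝ) * ((n : ℝ)⁻¹) ^ p ≤
      ∑ t : Fin n → ι, ∏ k, w (t k) := by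
    rw [← nsmul_eq_mul]
    refine (Finset.card_nsmul_le_sum _ (fun t : Fin n → ι => ∏ k, w (t k)) _ fun t ht => ?_).trans
      (Finset.sum_le_sum_of_subset_of_nonneg (Finset.subset_univ _)
        fun t _ _ => Finset.prod_nonneg fun k _ => hw0 _)
    rw [hprod]
    exact pow_le_pow_of_le_one (by positivity) (inv_le_one_of_one_le₀ hn')
      (Finset.mem_filter.1 ht).2.le
  have h6 := hle.trans hpow
  rw [inv_pow, ← div_eq_mul_inv, div_le_iff₀ (by positivity)] at h6
  linarith

namespace GradingProj

variable {K A G : Type*} [Field K] [Ring A] [Algebra K A] [Group G] {P : GradingProj K A G}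

namespace Frame

variable (Fr : P.Frame)

/-- The product `e i₁ * u₁ * e i₂ * u₂ * ⋯`. -/
def word (l : List (Fin Fr.n × A)) : A := (l.map fun x => Fr.e x.1 * x.2).prod

/-- A set of blocks is linked if there is a nonzero product passing once through each of them. -/
def Linked (I : Finset (Fin Fr.n)) : Prop :=
  ∃ l : List (Fin Fr.n × A),
    (l.map Prod.fst).Nodup ∧ (l.map Prod.fst).toFinset = I ∧ Fr.word l ≠ 0

lemma linked_of_prod_ne_zero {S : Type*} (f : S → A) (lab : S → Option (Fin Fr.n)) (l : List S)
    (h : ∀ x ∈ l, ∀ i, lab x = some i → Fr.e i * f x = f x) (h0 : (l.map f).prod ≠ 0)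
    (I : Finset (Fin Fr.n)) (hI : ∀ i, i ∈ I ↔ ∃ x ∈ l, lab x = some i) : Fr.Linked I := by
  have key : ∃ (m : List (Fin Fr.n × A)) (u : A), (m.map Prod.fst).Nodup ∧
      (∀ i, i ∈ m.map Prod.fst ↔ ∃ x ∈ l, lab x = some i) ∧
      (l.map f).prod = u * Fr.word m := by
    clear hI h0
    induction l with
    | nil => exact ⟨[], 1, by simp, by simp, by simp [word]⟩
    | cons x l ih =>
      obtain ⟨m, u, hm, hmem, hp⟩ := ih fun y hy => h y (List.mem_cons_of_mem _ hy)
      by_cases hx : ∃ i, lab x = some i ∧ i ∉ m.map Prod.fst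
      · obtain ⟨i, hi, him⟩ := hx
        refine ⟨(i, f x * u) :: m, 1, ?_, ?_, ?_⟩
        · rw [List.map_cons, List.nodup_cons]
          exact ⟨him, hm⟩
        · intro j
          rw [List.map_cons, List.mem_cons, hmem]
          simp only [List.mem_cons, exists_eq_or_imp, hi, Option.some.injEq]
          exact or_congr_left eq_comm
        · rw [List.map_cons, List.prod_cons, hp, word, word, List.map_cons, List.prod_cons,
            ← mul_assoc (Fr.e i), h x List.mem_cons_self i hi, one_mul, mul_assoc]
      · refine ⟨m, f x * u, hm, ?_, by rw [List.map_cons, List.prod_cons, hp, mul_assoc]⟩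
        intro j
        rw [hmem]
        simp only [List.mem_cons, exists_eq_or_imp]
        refine ⟨Or.inr, ?_⟩
        rintro (hj | hj)
        · by_contra hc
          exact hx ⟨j, hj, fun h => hc ((hmem j).1 h)⟩
        · exact hj
  obtain ⟨m, u, hm, hmem, hp⟩ := key
  refine ⟨m, hm, ?_, fun hw => h0 (by rw [hp, hw, mul_zero])⟩
  ext i
  rw [List.mem_toFinset, hmem, hI]

/-- There is a basis of the algebra each of whose elements lies in the radical or in a corner
`e i * A * e i`, such that the elements of the latter kind are linearly independent modulo the
radical. -/
lemma exists_labelled_basis [FiniteDimensional K A] :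
    ∃ (ι : Set A) (_ : Fintype ι) (b : Module.Basis ι K A) (lab : ι → Option (Fin Fr.n)),
      (∀ α, lab α = none → b α ∈ P.rad) ∧
      (∀ α i, lab α = some i → Fr.e i * b α * Fr.e i = b α) ∧
      ∀ I : Finset (Fin Fr.n), ∀ Y : Finset ι,
        (∀ α ∈ Y, ∃ i ∈ I, lab α = some i) → Y.card ≤ Fr.dim I := by
  classical
  obtain ⟨s, hs, -, hspan, hli⟩ := exists_linearIndepOn_extension (K := K) (v := id)
    (linearIndepOn_empty K id) (Set.empty_subset (P.rad : Set A))
  let t : Set A := P.rad ∪ {x | ∃ i, Fr.e i * x * Fr.e i = x}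
  obtain ⟨b, hb, hsb, hspan', hli'⟩ := exists_linearIndepOn_extension hli
    (hs.trans Set.subset_union_left : s ⊆ t)
  simp only [Set.image_id] at hspan hspan'
  have hradt : ∀ x ∈ P.rad, x ∈ Submodule.span K b := fun x hx => hspan' (Or.inl hx)
  have htop : ⊤ ≤ Submodule.span K (Set.range (Subtype.val : b → A)) := by
    intro x _
    rw [Subtype.range_coe]
    have h1 := hradt _ (Fr.sub_sum_e_mul_mul_e_mem_rad x)
    have h2 : ∑ i, Fr.e i * x * Fr.e i ∈ Submodule.span K b := by
      refine Submodule.sum_mem _ fun i _ => hspan' (Or.inr ⟨i, ?_⟩)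
      simp only [← mul_assoc, Fr.idem]
      rw [mul_assoc, Fr.idem]
    simpa using add_mem h1 h2
  let B : Module.Basis b K A := Module.Basis.mk hli' htop
  have hB : ∀ α : b, B α = α := fun α => Module.Basis.mk_apply hli' htop α
  have : Finite b := Module.Finite.finite_basis B
  let lab : b → Option (Fin Fr.n) := fun α =>
    if (α : A) ∈ P.rad then none else
      if h : ∃ i, Fr.e i * (α : A) * Fr.e i = α then some h.choose else none
  have hnone : ∀ α, lab α = none → (α : A) ∈ P.rad := by
    intro α hα
    by_contra hc
    have h := (hb α.2).resolve_left hc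
    simp only [lab, if_neg hc, dif_pos (show ∃ i, Fr.e i * (α : A) * Fr.e i = α from h)] at hα
    exact Option.some_ne_none _ hα
  have hsome : ∀ α i, lab α = some i → (α : A) ∉ P.rad ∧ Fr.e i * (α : A) * Fr.e i = α := by
    intro α i hα
    by_cases hc : (α : A) ∈ P.rad
    · simp [lab, hc] at hα
    · by_cases h : ∃ i, Fr.e i * (α : A) * Fr.e i = α
      · simp only [lab, if_neg hc, dif_pos h, Option.some.injEq] at hα
        exact ⟨hc, hα ▸ h.choose_spec⟩
      · simp [lab, hc, h] at hα
  refine ⟨b, Fintype.ofFinite b, B, lab, fun α hα => hB α ▸ hnone α hα,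
    fun α i hα => by rw [hB]; exact (hsome α i hα).2, fun I Y hY => ?_⟩
  have hdisj : Disjoint (Submodule.span K (Set.range fun α : Y => (α : A)))
      (LinearMap.ker ((Fr.block I).mkQ.restrictScalars K)) := by
    rw [Submodule.disjoint_def]
    intro x hx hxI
    have hxI : x ∈ Fr.block I := (Submodule.Quotient.mk_eq_zero _).1 hxI
    have hxrad : x ∈ P.rad := by
      refine Fr.mem_rad x fun j => ?_
      by_cases hj : j ∈ I
      · exact Fr.mem_block.1 hxI j hj
      · have : Submodule.span K (Set.range fun α : Y => (α : A)) ≤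
            (Fr.N j).restrictScalars K := by
          rw [Submodule.span_le]
          rintro _ ⟨α, rfl⟩
          obtain ⟨i, hi, hα⟩ := hY α α.2
          change ((α : b) : A) ∈ Fr.N j
          rw [← (hsome α i hα).2]
          exact P.mul_mem_of_mem_right _ _ (Fr.e_mem i j fun e => hj (e ▸ hi))
        exact this hx
    have hd := hli'.linearIndependent.disjoint_span_image (s := (Y : Set b))
      (t := {α : b | (α : A) ∈ s}) (by
        rw [Set.disjoint_left]
        intro α hα hαs
        obtain ⟨i, _, hα⟩ := hY α hα
        exact (hsome α i hα).1 (hs hαs))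
    refine Submodule.disjoint_def.1 hd x ?_ ?_
    · refine Submodule.span_mono ?_ hx
      rintro _ ⟨α, rfl⟩
      exact ⟨α, α.2, rfl⟩
    · refine Submodule.span_mono ?_ (hspan hxrad)
      intro y hy
      exact ⟨⟨y, hsb hy⟩, hy, rfl⟩
  have hliY : LinearIndependent K fun α : Y => ((α : b) : A) :=
    hli'.linearIndependent.comp (Subtype.val : Y → b) Subtype.val_injective
  have := (hliY.map hdisj).fintype_card_le_finrank
  rwa [Fintype.card_coe] at this

variable [FiniteDimensional K A] [CharZero K]

theorem codim_le {d : ℕ} (hd : 0 < d) (h : ∀ I, Fr.Linked I → Fr.dim I ≤ d) :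
    ∃ (C : ℝ) (p : ℕ), 0 < C ∧ ∀ n : ℕ, 0 < n →
      (P.codim n : ℝ) ≤ C * (n : ℝ) ^ p * (d : ℝ) ^ n := by
  classical
  obtain ⟨ι, _, b, lab, hnone, hsome, hcard⟩ := Fr.exists_labelled_basis
  obtain ⟨p, hp⟩ := P.isNilpotent_radIdeal
  let Y : Finset (Fin Fr.n) → Finset ι := fun I =>
    Finset.univ.filter fun α => ∃ i ∈ I, lab α = some i
  let good : Finset (Fin Fr.n) → ∀ n : ℕ, Finset (Fin n → ι) := fun I n =>
    Finset.univ.filter fun t => (Finset.univ.filter fun k => t k ∉ Y I).card < p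
  let S : Finset (Finset (Fin Fr.n)) := Finset.univ.filter fun I => Fr.Linked I
  have hvanish : ∀ n, ∀ t : Fin n → ι, t ∉ S.biUnion (fun I => good I n) →
      ∀ f ∈ P.multilin n, evalBasis b n f t = 0 := by
    intro n t ht f hf
    induction hf using Submodule.span_induction with
    | zero => simp
    | add f g _ _ hf hg => rw [map_add, Pi.add_apply, hf, hg, add_zero]
    | smul c f _ hf => rw [map_smul, Pi.smul_apply, hf, smul_zero]
    | mem f hf =>
      obtain ⟨l, hl, rfl⟩ := hf
      obtain ⟨σ, g, rfl⟩ := (perm_range_iff l).1 hl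
      by_contra hne
      have hmon : evalBasis b n (P.mon (List.ofFn fun k => (((σ k : Fin n) : ℕ), g k))) t =
          ((List.finRange n).map fun k => P.proj (g k) (b (t (σ k)))).prod := by
        change P.mon _ _ = _
        rw [mon, List.ofFn_eq_map, List.map_map]
        simp [Function.comp_def, extendZero_val]
      rw [hmon] at hne
      let I : Finset (Fin Fr.n) := Finset.univ.filter fun i => ∃ k, lab (t k) = some i
      have hlinked : Fr.Linked I := by
        refine Fr.linked_of_prod_ne_zero _ (fun k => lab (t (σ k))) _ ?_ hne I ?_
        · intro k _ i hi
          have h1 : Fr.e i * b (t (σ k)) = b (t (σ k)) := by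
            rw [← hsome _ _ hi, ← mul_assoc, ← mul_assoc, Fr.idem]
          rw [← P.proj_one_mul (Fr.proj_e i), h1]
        · intro i
          simp only [I, Finset.mem_filter, Finset.mem_univ, true_and, List.mem_finRange]
          exact ⟨fun ⟨k, hk⟩ => ⟨σ.symm k, by simpa using hk⟩, fun ⟨k, hk⟩ => ⟨_, hk⟩⟩
      refine ht (Finset.mem_biUnion.2 ⟨I, by simpa [S] using hlinked, ?_⟩)
      simp only [good, Finset.mem_filter, Finset.mem_univ, true_and]
      by_contra hge
      rw [not_lt] at hge
      have hmem := P.radIdeal.list_prod_mem_pow (fun k => P.proj (g k) (b (t (σ k))))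
        (fun k => if lab (t (σ k)) = none then 1 else 0) (List.finRange n) (fun k _ => by
          by_cases hk : lab (t (σ k)) = none
          · rw [if_pos hk, Submodule.pow_one]
            exact P.proj_mem_of_mem _ _ (hnone _ hk)
          · rw [if_neg hk, Submodule.pow_zero, Ideal.one_eq_top]
            trivial)
      have hcount : ((List.finRange n).map fun k => if lab (t (σ k)) = none then 1 else 0).sum =
          (Finset.univ.filter fun k => t k ∉ Y I).card := by
        rw [← List.ofFn_eq_map, List.sum_ofFn,
          Equiv.sum_comp σ fun k => if lab (t k) = none then 1 else 0, Finset.card_filter]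
        refine Finset.sum_congr rfl fun k _ => ?_
        congr 1
        simp only [Y, I, Finset.mem_filter, Finset.mem_univ, true_and, eq_iff_iff]
        constructor
        · rintro hk ⟨i, _, hi⟩
          simp [hk] at hi
        · intro hk
          by_contra hc
          obtain ⟨i, hi⟩ := Option.ne_none_iff_exists'.1 hc
          exact hk ⟨i, ⟨k, hi⟩, hi⟩
      rw [hcount] at hmem
      have hz := Ideal.pow_le_pow_right hge hmem
      rw [hp] at hz
      exact hne hz
  have hdim : ∀ n, P.codim n ≤ (S.biUnion fun I => good I n).card * Module.finrank K A := by
    intro n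
    set T := S.biUnion fun I => good I n with hT
    let ρ : ((Fin n → ι) → A) →ₗ[K] (T → A) := LinearMap.funLeft K A Subtype.val
    have hinj : Function.Injective (ρ.domRestrict ((P.multilin n).map (evalBasis b n))) := by
      rw [injective_iff_map_eq_zero]
      rintro ⟨_, f, hf, rfl⟩ h0
      refine Subtype.ext (funext fun t => ?_)
      by_cases ht : t ∈ T
      · exact congrFun h0 ⟨t, ht⟩
      · exact hvanish n t ht f hf
    rw [P.codim_eq_evalBasis b]
    refine (LinearMap.finrank_le_finrank_of_injective hinj).trans ?_
    rw [Module.finrank_pi_fintype, Finset.sum_const, Finset.card_univ, Fintype.card_coe,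
      smul_eq_mul]
  refine ⟨S.card * Real.exp (Fintype.card ι) * Module.finrank K A + 1, p, by positivity,
    fun n hn => ?_⟩
  have h1 : ((S.biUnion fun I => good I n).card : ℝ) ≤
      S.card * (Real.exp (Fintype.card ι) * (n : ℝ) ^ p * (d : ℝ) ^ n) := by
    refine (Nat.cast_le.2 Finset.card_biUnion_le).trans ?_
    rw [Nat.cast_sum, ← nsmul_eq_mul]
    refine Finset.sum_le_card_nsmul _ _ _ fun I hI => ?_
    refine card_filter_card_filter_lt_le (Y I) p n hn hd ?_
    refine (hcard I (Y I) fun α hα => ?_).trans (h I (Finset.mem_filter.1 hI).2)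
    simpa [Y] using hα
  have h2 : (P.codim n : ℝ) ≤ (S.biUnion fun I => good I n).card * Module.finrank K A := by
    exact_mod_cast hdim n
  have h3 : (0 : ℝ) ≤ (n : ℝ) ^ p * (d : ℝ) ^ n := by positivity
  have h4 : (0 : ℝ) ≤ Module.finrank K A := by positivity
  nlinarith [mul_le_mul_of_nonneg_right h1 h4]

end Frame

end GradingProj

namespace GradingProj

variable {K A G : Type*} [Field K] [Ring A] [Algebra K A] [Group G] {P : GradingProj K A G}

namespace Frame

variable (Fr : P.Frame)

/-- The product `e i₁ * Y i₁ * e i₁ * u₁ * e i₂ * Y i₂ * e i₂ * u₂ * ⋯`. -/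
def chain (l : List (Fin Fr.n × A)) (Y : Fin Fr.n → A) : A :=
  (l.map fun x => Fr.e x.1 * Y x.1 * Fr.e x.1 * x.2).prod

@[simp] lemma chain_cons (x : Fin Fr.n × A) (l : List (Fin Fr.n × A)) (Y : Fin Fr.n → A) :
    Fr.chain (x :: l) Y = Fr.e x.1 * Y x.1 * Fr.e x.1 * x.2 * Fr.chain l Y := by
  simp [chain]

lemma chain_one (l : List (Fin Fr.n × A)) : Fr.chain l (fun _ => 1) = Fr.word l := by
  simp [chain, word, Fr.idem]

lemma chain_congr {l : List (Fin Fr.n × A)} {Y Z : Fin Fr.n → A}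
    (h : ∀ i ∈ l.map Prod.fst, Y i = Z i) : Fr.chain l Y = Fr.chain l Z := by
  unfold chain
  congr 1
  refine List.map_congr_left fun x hx => ?_
  rw [h _ (List.mem_map_of_mem hx)]

lemma exists_chain_update {l : List (Fin Fr.n × A)} (hl : (l.map Prod.fst).Nodup)
    {i : Fin Fr.n} (hi : i ∈ l.map Prod.fst) (Y : Fin Fr.n → A) :
    ∃ p q : A, ∀ y, Fr.chain l (Function.update Y i y) = p * (Fr.e i * y) * q := by
  induction l with
  | nil => simp at hi
  | cons x l ih =>
    rw [List.map_cons, List.nodup_cons] at hl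
    rw [List.map_cons, List.mem_cons] at hi
    rcases hi with rfl | hi
    · refine ⟨1, Fr.e x.1 * x.2 * Fr.chain l Y, fun y => ?_⟩
      rw [chain_cons, Function.update_self, Fr.chain_congr (Z := Y)]
      · noncomm_ring
      · intro j hj
        exact Function.update_of_ne (fun e : j = x.1 => hl.1 (by rwa [← e])) _ _
    · obtain ⟨p, q, h⟩ := ih hl.2 hi
      refine ⟨Fr.e x.1 * Y x.1 * Fr.e x.1 * x.2 * p, q, fun y => ?_⟩
      rw [chain_cons, h, Function.update_of_ne fun e : x.1 = i => hl.1 (by rwa [e])]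
      noncomm_ring

lemma chain_update_mul {l : List (Fin Fr.n × A)} (hl : (l.map Prod.fst).Nodup)
    {i : Fin Fr.n} (hi : i ∈ l.map Prod.fst)
    (hrigid : ∀ Y : Fin Fr.n → A, Y i ∈ P.rad → Fr.chain l Y = 0) {t : A} {c : K}
    (ht : t - c • Fr.e i ∈ P.rad) (Y : Fin Fr.n → A) :
    Fr.chain l (Function.update Y i (t * Y i)) = c • Fr.chain l Y := by
  obtain ⟨p, q, h⟩ := Fr.exists_chain_update hl hi Y
  have h0 := hrigid (Function.update Y i ((t - c • Fr.e i) * Y i)) (by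
    rw [Function.update_self]
    exact P.mul_mem_of_mem_left _ _ ht)
  have h1 := h (Y i)
  rw [Function.update_eq_self] at h1
  have h2 : Fr.e i * (c • Fr.e i * Y i) = c • (Fr.e i * Y i) := by
    rw [smul_mul_assoc, mul_smul_comm, ← mul_assoc, Fr.idem i]
  rw [h, sub_mul, mul_sub, h2, mul_sub, sub_mul, sub_eq_zero] at h0
  rw [h, h0, h1, mul_smul_comm, smul_mul_assoc]

variable [FiniteDimensional K A] [CharZero K]

/-- A linked set of blocks admits a chain which is rigid, in the sense that it vanishes as soon as
one of its arguments lies in the radical. -/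
lemma exists_rigid_chain {I : Finset (Fin Fr.n)} (hI : Fr.Linked I) :
    ∃ l : List (Fin Fr.n × A), (l.map Prod.fst).Nodup ∧ (l.map Prod.fst).toFinset = I ∧
      Fr.word l ≠ 0 ∧ ∀ i ∈ I, ∀ Y : Fin Fr.n → A, Y i ∈ P.rad → Fr.chain l Y = 0 := by
  classical
  obtain ⟨p, hp⟩ := P.isNilpotent_radIdeal
  let Q : ℕ → Prop := fun k => ∃ (l : List (Fin Fr.n × A)) (w : Fin Fr.n → ℕ),
    (l.map Prod.fst).Nodup ∧ (l.map Prod.fst).toFinset = I ∧ Fr.word l ≠ 0 ∧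
      (∀ x ∈ l, x.2 ∈ P.radIdeal ^ w x.1) ∧ ∑ i ∈ I, w i = k
  have hbound : ∀ k, Q k → k ≤ p := by
    rintro k ⟨l, w, hl, hlI, hne, hmem, rfl⟩
    by_contra hlt
    have h1 := P.radIdeal.list_prod_mem_pow (fun x : Fin Fr.n × A => Fr.e x.1 * x.2)
      (fun x => w x.1) l fun x hx => Ideal.mul_mem_left _ _ (hmem x hx)
    have h2 : (l.map fun x => w x.1).sum = ∑ i ∈ I, w i := by
      rw [← hlI, List.sum_toFinset _ hl, List.map_map]
      rfl
    rw [h2] at h1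
    have h3 := Ideal.pow_le_pow_right (not_le.1 hlt).le h1
    rw [hp] at h3
    exact hne h3
  have h0 : Q 0 := by
    obtain ⟨l, hl, hlI, hne⟩ := hI
    refine ⟨l, fun _ => 0, hl, hlI, hne, fun x _ => ?_, by simp⟩
    rw [Submodule.pow_zero, Ideal.one_eq_top]
    trivial
  obtain ⟨l, w, hl, hlI, hne, hmem, hw⟩ : Q (Nat.findGreatest Q p) :=
    Nat.findGreatest_spec (Nat.zero_le p) h0
  refine ⟨l, hl, hlI, hne, fun i hi Y hY => ?_⟩
  by_contra hc
  have hmarkers : (l.map fun x => (x.1, Y x.1 * Fr.e x.1 * x.2)).map Prod.fst = l.map Prod.fst := by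
    rw [List.map_map]
    rfl
  have hQ : Q (Nat.findGreatest Q p + 1) := by
    refine ⟨l.map fun x => (x.1, Y x.1 * Fr.e x.1 * x.2), Function.update w i (w i + 1),
      by rwa [hmarkers], by rwa [hmarkers], ?_, ?_, ?_⟩
    · rw [word, List.map_map]
      intro h
      refine hc ?_
      rw [← h, chain]
      congr 1
      refine List.map_congr_left fun x _ => ?_
      simp [mul_assoc]
    · intro x hx
      obtain ⟨x, hxl, rfl⟩ := List.mem_map.1 hx
      by_cases hxi : x.1 = i
      · simp only [hxi, Function.update_self]
        rw [add_comm, Ideal.IsTwoSided.pow_add, Submodule.pow_one]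
        refine Ideal.mul_mem_mul (P.mul_mem_of_mem_left _ _ hY) ?_
        have := hmem x hxl
        rwa [hxi] at this
      · simp only [Function.update_of_ne hxi]
        exact Ideal.mul_mem_left _ _ (hmem x hxl)
    · rw [Finset.sum_update_of_mem hi, ← hw, ← Finset.add_sum_erase _ _ hi,
          Finset.sdiff_singleton_eq_erase]
      ring
  have := Nat.le_findGreatest (hbound _ hQ) hQ
  omega

end Frame

end GradingProj

lemma Submodule.finrank_iSup_le {K V ι : Type*} [Field K] [AddCommGroup V] [Module K V] [Fintype ι]
    (p : ι → Submodule K V) [∀ i, FiniteDimensional K (p i)] :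
    Module.finrank K ↥(⨆ i, p i) ≤ ∑ i, Module.finrank K (p i) := by
  classical
  suffices h : ∀ s : Finset ι, FiniteDimensional K ↥(s.sup p) ∧
      Module.finrank K ↥(s.sup p) ≤ ∑ i ∈ s, Module.finrank K (p i) by
    rw [← Finset.sup_univ_eq_iSup]
    exact (h Finset.univ).2
  intro s
  induction s using Finset.induction_on with
  | empty => exact ⟨by rw [Finset.sup_empty]; infer_instance, by simp⟩
  | insert i s hi ih =>
    have := ih.1
    rw [Finset.sup_insert, Finset.sum_insert hi]
    exact ⟨inferInstance, (Submodule.finrank_add_le_finrank_add_finrank _ _).trans (by omega)⟩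

namespace GradingProj

section Words

variable {K A G : Type*} [Field K] [Ring A] [Algebra K A] [Group G] (P : GradingProj K A G)

lemma finiteDimensional_multilin [FiniteDimensional K A] (n : ℕ) :
    FiniteDimensional K (P.multilin n) := by
  let b := Module.finBasis K A
  refine FiniteDimensional.of_injective ((evalBasis b n).domRestrict (P.multilin n)) ?_
  rw [injective_iff_map_eq_zero]
  rintro ⟨f, hf⟩ h
  exact Subtype.ext (P.eq_zero_of_basis hf b fun t => congrFun h t)

variable {ι : Type*} (b : Module.Basis ι K A)

/-- The function computed by a graded monomial whose letters are variables and basis vectors. -/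
noncomputable def wordVal (w : List ((ι ⊕ ℕ) × G)) (a : ℕ → A) : A :=
  (w.map fun p => P.proj p.2 (Sum.elim b a p.1)).prod

/-- The variables of a monomial. -/
def wordVars (w : List ((ι ⊕ ℕ) × G)) : List ℕ := w.filterMap fun p => p.1.getRight?

/-- The number of basis vectors in a monomial. -/
def wordConsts (w : List ((ι ⊕ ℕ) × G)) : ℕ := w.countP fun p => p.1.isLeft

/-- The functions computed by the generalized graded polynomials of multidegree `X` with `s`
coefficients in every monomial. -/
def genPolys (X : Multiset ℕ) (s : ℕ) : Submodule K ((ℕ → A) → A) :=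
  Submodule.span K {f | ∃ w : List ((ι ⊕ ℕ) × G), (wordVars w : Multiset ℕ) = X ∧
    wordConsts w = s ∧ f = P.wordVal b w}

variable {b}

lemma genPolys_mul {X Y : Multiset ℕ} {s t : ℕ} {f g : (ℕ → A) → A}
    (hf : f ∈ P.genPolys b X s) (hg : g ∈ P.genPolys b Y t) :
    f * g ∈ P.genPolys b (X + Y) (s + t) := by
  have h : P.genPolys b X s * P.genPolys b Y t ≤ P.genPolys b (X + Y) (s + t) := by
    rw [genPolys, genPolys, Submodule.span_mul_span, genPolys]
    refine Submodule.span_mono ?_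
    rintro _ ⟨_, ⟨w, rfl, rfl, rfl⟩, _, ⟨w', rfl, rfl, rfl⟩, rfl⟩
    refine ⟨w ++ w', ?_, ?_, ?_⟩
    · simp [wordVars]
    · simp [wordConsts]
    · ext a
      simp [wordVal]
  exact h (Submodule.mul_mem_mul hf hg)

lemma one_mem_genPolys : 1 ∈ P.genPolys b 0 0 :=
  Submodule.subset_span ⟨[], rfl, rfl, rfl⟩

lemma const_mem_genPolys [Finite ι] (c : A) : (fun _ => c) ∈ P.genPolys b 0 1 := by
  have := Fintype.ofFinite ι
  have h : (fun _ : ℕ → A => c) = ∑ i, b.repr c i • ∑ g ∈ P.supp, P.wordVal b [(Sum.inl i, g)] := by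
    ext a
    simp [wordVal, P.sum_proj, b.sum_repr]
  rw [h]
  refine Submodule.sum_mem _ fun i _ => Submodule.smul_mem _ _ (Submodule.sum_mem _ fun g _ => ?_)
  exact Submodule.subset_span ⟨_, rfl, rfl, rfl⟩

lemma var_mem_genPolys (v : ℕ) : (fun a => a v) ∈ P.genPolys b {v} 0 := by
  have h : (fun a : ℕ → A => a v) = ∑ g ∈ P.supp, P.wordVal b [(Sum.inr v, g)] := by
    ext a
    simp [wordVal, P.sum_proj]
  rw [h]
  exact Submodule.sum_mem _ fun g _ => Submodule.subset_span ⟨_, rfl, rfl, rfl⟩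

lemma proj_wordVal (w : List ((ι ⊕ ℕ) × G)) (a : ℕ → A) :
    P.proj (w.map Prod.snd).prod (P.wordVal b w a) = P.wordVal b w a := by
  induction w with
  | nil => simpa [wordVal] using P.proj_one_one
  | cons p w ih =>
    have h : P.wordVal b (p :: w) a = P.proj p.2 (Sum.elim b a p.1) * P.wordVal b w a := by
      simp [wordVal]
    rw [h, List.map_cons, List.prod_cons, ← ih, P.proj_mul_self]

lemma proj_mem_genPolys {X : Multiset ℕ} {s : ℕ} {f : (ℕ → A) → A}
    (hf : f ∈ P.genPolys b X s) (g : G) : (fun a => P.proj g (f a)) ∈ P.genPolys b X s := by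
  induction hf using Submodule.span_induction with
  | mem f hf =>
    obtain ⟨w, hX, hs, rfl⟩ := hf
    by_cases hg : g = (w.map Prod.snd).prod
    · subst hg
      simp only [proj_wordVal]
      exact Submodule.subset_span ⟨w, hX, hs, rfl⟩
    · have h : (fun a => P.proj g (P.wordVal b w a)) = 0 := by
        ext a
        rw [← P.proj_wordVal w a, P.proj_proj_ne _ _ _ hg]
        rfl
      rw [h]
      exact Submodule.zero_mem _
  | zero =>
    simp only [Pi.zero_apply, map_zero]
    exact Submodule.zero_mem _
  | add f f' _ _ hf hf' =>
    simp only [Pi.add_apply, map_add]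
    exact Submodule.add_mem _ hf hf'
  | smul c f _ hf =>
    simp only [Pi.smul_apply, map_smul]
    exact Submodule.smul_mem _ c hf

lemma exists_mon_eq_wordVal [Nonempty ι] {n : ℕ} (w : List ((ι ⊕ ℕ) × G))
    (hw : ∀ v ∈ wordVars w, v < n) : ∀ k, n ≤ k → ∃ (l : List (ℕ × G)) (c : ℕ → ι),
      (l.map Prod.fst).Perm (wordVars w ++ List.range' k (wordConsts w)) ∧
      ∀ a, P.wordVal b w a = P.mon l fun v => if v < n then a v else b (c v) := by
  classical
  induction w with
  | nil => exact fun k _ => ⟨[], fun _ => Classical.arbitrary ι, by simp [wordVars, wordConsts],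
      fun a => by simp [wordVal]⟩
  | cons p w ih =>
    intro k hk
    obtain ⟨p, g⟩ := p
    rcases p with i | v
    · have hv : wordVars ((Sum.inl i, g) :: w) = wordVars w := rfl
      have hc : wordConsts ((Sum.inl i, g) :: w) = wordConsts w + 1 :=
        List.countP_cons_of_pos rfl
      rw [hv] at hw
      obtain ⟨l, c, hl, h⟩ := ih hw (k + 1) (by omega)
      refine ⟨(k, g) :: l, Function.update c k i, ?_, fun a => ?_⟩
      · rw [hv, hc, List.range'_succ, List.map_cons]
        exact (hl.cons k).trans List.perm_middle.symm
      · have h1 : P.wordVal b ((Sum.inl i, g) :: w) a = P.proj g (b i) * P.wordVal b w a := by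
          simp [wordVal]
        rw [h1, h, mon_cons]
        congr 1
        · simp [not_lt.2 hk]
        · refine P.mon_congr fun v hv => ?_
          have hvk : v ≠ k := by
            rintro rfl
            rcases List.mem_append.1 (hl.mem_iff.1 hv) with hv | hv
            · exact absurd (hw _ hv) (by omega)
            · have := (List.mem_range'_1.1 hv).1
              omega
          rw [Function.update_of_ne hvk]
    · have hv : wordVars ((Sum.inr v, g) :: w) = v :: wordVars w := rfl
      have hc : wordConsts ((Sum.inr v, g) :: w) = wordConsts w :=
        List.countP_cons_of_neg Bool.false_ne_true
      rw [hv] at hw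
      obtain ⟨l, c, hl, h⟩ := ih (fun u hu => hw u (List.mem_cons_of_mem _ hu)) k hk
      refine ⟨(v, g) :: l, c, ?_, fun a => ?_⟩
      · rw [hv, hc, List.map_cons]
        exact hl.cons v
      · have h1 : P.wordVal b ((Sum.inr v, g) :: w) a = P.proj g (a v) * P.wordVal b w a := by
          simp [wordVal]
        rw [h1, h, mon_cons]
        simp [hw v (by simp)]

/-- Substitution of basis vectors for all variables but the first `n` ones. -/
def substConsts (b : ι → A) (n : ℕ) {s : ℕ} (τ : Fin s → ι) (a : ℕ → A) (v : ℕ) : A :=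
  if v < n then a v else if h : v - n < s then b (τ ⟨v - n, h⟩) else 0

lemma genPolys_range_le [Nonempty ι] (n s : ℕ) : P.genPolys b (Multiset.range n) s ≤
    ⨆ τ : Fin s → ι, (P.multilin (n + s)).map (LinearMap.funLeft K A (substConsts b n τ)) := by
  refine Submodule.span_le.2 ?_
  rintro _ ⟨w, hX, rfl, rfl⟩
  have hperm : (wordVars w).Perm (List.range n) := Multiset.coe_eq_coe.1 hX
  obtain ⟨l, c, hl, h⟩ := P.exists_mon_eq_wordVal (b := b) w
    (fun v hv => List.mem_range.1 (hperm.mem_iff.1 hv)) n le_rfl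
  have hl' : (l.map Prod.fst).Perm (List.range (n + wordConsts w)) := by
    refine hl.trans ((hperm.append_right _).trans ?_)
    rw [List.range_eq_range', List.range_eq_range', ← List.range'_append_1, zero_add]
  refine Submodule.mem_iSup_of_mem (fun j => c (n + j)) ⟨P.mon l, Submodule.subset_span
    ⟨l, hl', rfl⟩, ?_⟩
  ext a
  rw [h, LinearMap.funLeft_apply]
  refine P.mon_congr fun v hv => ?_
  have hv' := List.mem_range.1 (hl'.mem_iff.1 hv)
  unfold substConsts
  split_ifs with h1 h2
  · rfl
  · simp only
    rw [Nat.add_sub_cancel' (not_lt.1 h1)]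
  · omega

variable [Finite ι]

lemma genPolys_mono {X : Multiset ℕ} {s t : ℕ} (h : s ≤ t) :
    P.genPolys b X s ≤ P.genPolys b X t := by
  induction t, h using Nat.le_induction with
  | base => exact le_rfl
  | succ t _ ih =>
    refine ih.trans fun f hf => ?_
    have := P.genPolys_mul hf (P.const_mem_genPolys (b := b) 1)
    rw [add_zero] at this
    convert this
    ext a
    simp

lemma exists_smul_mem_genPolys (T : P.opAlg) : ∃ o, ∀ X s, ∀ f ∈ P.genPolys b X s,
    (fun a => T • f a) ∈ P.genPolys b X (s + o) := by
  induction T using P.opAlg_induction with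
  | hL c =>
    refine ⟨1, fun X s f hf => ?_⟩
    rw [add_comm s]
    have := P.genPolys_mul (P.const_mem_genPolys (b := b) c) hf
    rwa [zero_add] at this
  | hR c =>
    refine ⟨1, fun X s f hf => ?_⟩
    have := P.genPolys_mul hf (P.const_mem_genPolys (b := b) c)
    rwa [add_zero] at this
  | hP g => exact ⟨0, fun X s f hf => P.proj_mem_genPolys hf g⟩
  | hadd S T hS hT =>
    obtain ⟨o, ho⟩ := hS
    obtain ⟨o', ho'⟩ := hT
    refine ⟨o + o', fun X s f hf => ?_⟩
    simp only [add_smul]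
    exact Submodule.add_mem _ (P.genPolys_mono (by omega) (ho X s f hf))
      (P.genPolys_mono (by omega) (ho' X s f hf))
  | hmul S T hS hT =>
    obtain ⟨o, ho⟩ := hS
    obtain ⟨o', ho'⟩ := hT
    refine ⟨o' + o, fun X s f hf => ?_⟩
    simp only [mul_smul, ← add_assoc]
    exact ho _ _ _ (ho' X s f hf)

lemma finrank_genPolys_le [Nonempty ι] (n s : ℕ) :
    FiniteDimensional K (P.genPolys b (Multiset.range n) s) ∧
      Module.finrank K (P.genPolys b (Multiset.range n) s) ≤ Nat.card ι ^ s * P.codim (n + s) := by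
  have := Fintype.ofFinite ι
  have := Module.Finite.of_basis b
  have := P.finiteDimensional_multilin (n + s)
  have hle := P.genPolys_range_le (b := b) n s
  refine ⟨Submodule.finiteDimensional_of_le hle, (Submodule.finrank_mono hle).trans
    ((Submodule.finrank_iSup_le _).trans ?_)⟩
  calc _ ≤ ∑ τ : Fin s → ι, P.codim (n + s) :=
        Finset.sum_le_sum fun τ _ => Submodule.finrank_map_le _ _
    _ = _ := by simp

end Words

end GradingProj

lemma Matrix.sum_det_updateCol_mul {n R : Type*} [Fintype n] [DecidableEq n] [CommRing R]
    (T M : Matrix n n R) :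
    ∑ j, (M.updateCol j fun i => (T * M) i j).det = T.trace * M.det := by
  have h : ∀ j, (M.updateCol j fun i => (T * M) i j).det = (M.adjugate * (T * M)) j j := by
    intro j
    rw [← Matrix.cramer_apply, Matrix.cramer_eq_adjugate_mulVec]
    rfl
  calc _ = (M.adjugate * (T * M)).trace := Finset.sum_congr rfl fun j _ => h j
    _ = (T * (M * M.adjugate)).trace := by
      rw [Matrix.trace_mul_comm, Matrix.mul_assoc]
    _ = _ := by
      rw [Matrix.mul_adjugate, Matrix.mul_smul, Matrix.mul_one, Matrix.trace_smul, smul_eq_mul,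
        mul_comm]

namespace GradingProj

variable {K A G : Type*} [Field K] [Ring A] [Algebra K A] [Group G] {P : GradingProj K A G}

namespace Frame

variable (Fr : P.Frame)

/-- A nonzero product linking the given blocks such that the corresponding chain only depends on
its arguments modulo the radical. -/
structure RigidChain (I : Finset (Fin Fr.n)) where
  /-- The idempotents and the linking elements. -/
  l : List (Fin Fr.n × A)
  nodup : (l.map Prod.fst).Nodup
  toFinset_eq : (l.map Prod.fst).toFinset = I
  word_ne_zero : Fr.word l ≠ 0
  rigid : ∀ i ∈ I, ∀ Y : Fin Fr.n → A, Y i ∈ P.rad → Fr.chain l Y = 0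

lemma Linked.nonempty_rigidChain [FiniteDimensional K A] [CharZero K] {Fr : P.Frame}
    {I : Finset (Fin Fr.n)} (hI : Fr.Linked I) : Nonempty (Fr.RigidChain I) := by
  obtain ⟨l, h1, h2, h3, h4⟩ := Fr.exists_rigid_chain hI
  exact ⟨⟨l, h1, h2, h3, h4⟩⟩

namespace RigidChain

variable {Fr} {I : Finset (Fin Fr.n)} (C : Fr.RigidChain I)

lemma mem_iff {i : Fin Fr.n} : i ∈ C.l.map Prod.fst ↔ i ∈ I := by
  rw [← List.mem_toFinset, C.toFinset_eq]

variable {ι : Type*} (b : Module.Basis ι K A)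

/-- The span of the functions obtained by substituting generalized graded polynomials of total
multidegree `Z` with at most `t` coefficients for the arguments of the chain. -/
def polys (Z : Multiset ℕ) (t : ℕ) : Submodule K ((ℕ → A) → A) :=
  Submodule.span K {f | ∃ (z : Fin Fr.n → Multiset ℕ) (s : Fin Fr.n → ℕ)
    (Y : Fin Fr.n → (ℕ → A) → A), (∀ i ∈ I, Y i ∈ P.genPolys b (z i) (s i)) ∧
      ∑ i ∈ I, z i = Z ∧ ∑ i ∈ I, s i ≤ t ∧ f = fun a => Fr.chain C.l fun i => Y i a}

variable {b}

lemma word_mem_polys : (fun _ => Fr.word C.l) ∈ C.polys b 0 0 := by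
  refine Submodule.subset_span ⟨0, 0, fun _ => 1, fun i _ => P.one_mem_genPolys, by simp, by simp,
    ?_⟩
  ext a
  exact (Fr.chain_one _).symm

variable [Finite ι]

lemma _root_.GradingProj.Frame.chain_mem_genPolys (z : Fin Fr.n → Multiset ℕ) (s : Fin Fr.n → ℕ)
    (Y : Fin Fr.n → (ℕ → A) → A) (l : List (Fin Fr.n × A))
    (hY : ∀ i ∈ l.map Prod.fst, Y i ∈ P.genPolys b (z i) (s i)) :
    (fun a => Fr.chain l fun i => Y i a) ∈ P.genPolys b ((l.map Prod.fst).map z).sum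
      (((l.map Prod.fst).map s).sum + 3 * l.length) := by
  induction l with
  | nil => exact P.one_mem_genPolys
  | cons x l ih =>
    have h1 := ih fun i hi => hY i (List.mem_cons_of_mem _ hi)
    have h2 := P.genPolys_mul (P.genPolys_mul (P.genPolys_mul (P.genPolys_mul
      (P.const_mem_genPolys (b := b) (Fr.e x.1)) (hY x.1 List.mem_cons_self))
      (P.const_mem_genPolys (b := b) (Fr.e x.1))) (P.const_mem_genPolys (b := b) x.2)) h1
    convert h2 using 1
    · congr 1
      · simp
      · simp
        ring
    · ext a
      exact Fr.chain_cons _ _ _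

lemma exists_polys_le : ∃ o, ∀ Z t, C.polys b Z t ≤ P.genPolys b Z (t + o) := by
  refine ⟨3 * C.l.length, fun Z t => Submodule.span_le.2 ?_⟩
  rintro _ ⟨z, s, Y, hY, rfl, hs, rfl⟩
  have h := chain_mem_genPolys z s Y C.l fun i hi => hY i (C.mem_iff.1 hi)
  rw [← List.sum_toFinset _ C.nodup, ← List.sum_toFinset _ C.nodup, C.toFinset_eq] at h
  exact P.genPolys_mono (Nat.add_le_add_right hs _) h

variable [FiniteDimensional K A] [IsAlgClosed K]

lemma exists_functional_smul_mem_polys (φ : A →ₗ[K] K) (hφ : ∀ x ∈ Fr.block I, φ x = 0) :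
    ∃ o, ∀ X s, ∀ x ∈ P.genPolys b X s, ∀ Z t, ∀ f ∈ C.polys b Z t,
      (fun a => φ (x a) • f a) ∈ C.polys b (X + Z) (s + t + o) := by
  classical
  have hψ : ∀ i : Fin Fr.n, ∀ x ∈ Fr.N i, (φ ∘ₗ LinearMap.mulLeft K (Fr.e i)) x = 0 := by
    intro i x hx
    refine hφ _ (Fr.mem_block.2 fun j _ => ?_)
    by_cases hj : i = j
    · subst hj
      exact P.mul_mem_of_mem_right _ _ hx
    · exact P.mul_mem_of_mem_left _ _ (Fr.e_mem i j hj)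
  choose T hT using fun i => Fr.exists_op_of_functional i _ (hψ i)
  choose o ho using fun i => P.exists_smul_mem_genPolys (b := b) (T i)
  refine ⟨∑ i, o i, fun X s x hx Z t f hf => ?_⟩
  have hsum : ∀ y, φ y = ∑ i ∈ I, φ (Fr.e i * y) := by
    intro y
    have := hφ _ (Fr.sub_sum_mem_block I y)
    rwa [map_sub, sub_eq_zero, map_sum] at this
  have h1 : (fun a => φ (x a) • f a) = ∑ i ∈ I, fun a => φ (Fr.e i * x a) • f a := by
    ext a
    rw [hsum, Finset.sum_smul, Finset.sum_apply]
  rw [h1]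
  clear h1
  refine Submodule.sum_mem _ fun i hi => ?_
  induction hf using Submodule.span_induction with
  | mem f hf =>
    obtain ⟨z, u, Y, hY, rfl, hu, rfl⟩ := hf
    refine Submodule.subset_span ⟨Function.update z i (X + z i),
      Function.update u i (s + o i + u i),
      Function.update Y i fun a => (T i • x a) * Y i a, fun j hj => ?_, ?_, ?_, ?_⟩
    · by_cases hji : j = i
      · subst hji
        simp only [Function.update_self]
        exact P.genPolys_mul (ho j X s x hx) (hY j hj)
      · simp only [Function.update_of_ne hji]
        exact hY j hj
    · rw [Finset.sum_update_of_mem hi, ← Finset.add_sum_erase _ _ hi,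
        Finset.sdiff_singleton_eq_erase, add_assoc]
    · rw [Finset.sum_update_of_mem hi, Finset.sdiff_singleton_eq_erase]
      have := Finset.add_sum_erase _ u hi
      have := Finset.single_le_sum (f := o) (fun _ _ => Nat.zero_le _) (Finset.mem_univ i)
      omega
    · ext a
      refine (Fr.chain_update_mul C.nodup (C.mem_iff.2 hi) (C.rigid i hi) (hT i (x a))
        fun j => Y j a).symm.trans ?_
      congr 1
      ext j
      by_cases hji : j = i
      · subst hji
        simp
      · simp [Function.update_of_ne hji]
  | zero =>
    simp only [Pi.zero_apply, smul_zero]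
    exact Submodule.zero_mem _
  | add f g _ _ hf hg =>
    simp only [Pi.add_apply, smul_add]
    exact Submodule.add_mem _ hf hg
  | smul c f _ hf =>
    simp only [Pi.smul_apply, smul_comm _ c]
    exact Submodule.smul_mem _ c hf

lemma exists_det_smul_mem_polys {d : ℕ} (φ : Fin d → A →ₗ[K] K)
    (hφ : ∀ i, ∀ x ∈ Fr.block I, φ i x = 0) :
    ∃ o, ∀ (X : Fin d → Multiset ℕ) (s : Fin d → ℕ) (x : Fin d → (ℕ → A) → A),
      (∀ j, x j ∈ P.genPolys b (X j) (s j)) → ∀ Z t, ∀ f ∈ C.polys b Z t,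
      (fun a => (Matrix.of fun i j => φ i (x j a)).det • f a) ∈
        C.polys b (∑ j, X j + Z) (∑ j, s j + t + o) := by
  choose o ho using fun i => C.exists_functional_smul_mem_polys (b := b) (φ i) (hφ i)
  refine ⟨∑ i, o i, fun X s x hx Z t f hf => ?_⟩
  have hprod : ∀ (σ : Equiv.Perm (Fin d)) (J : Finset (Fin d)),
      (fun a => (∏ i ∈ J, φ (σ i) (x i a)) • f a) ∈
        C.polys b (∑ j ∈ J, X j + Z) (∑ j ∈ J, s j + t + ∑ j ∈ J, o (σ j)) := by
    intro σ J
    induction J using Finset.induction_on with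
    | empty => simpa using hf
    | insert i J hi ih =>
      have := ho (σ i) _ _ _ (hx i) _ _ _ ih
      simp only [Finset.prod_insert hi, Finset.sum_insert hi, mul_smul]
      convert this using 1
      congr 1
      · rw [add_assoc]
      · ring
  have h : (fun a => (Matrix.of fun i j => φ i (x j a)).det • f a) =
      ∑ σ : Equiv.Perm (Fin d), ((Equiv.Perm.sign σ : ℤ) : K) •
        fun a => (∏ i, φ (σ i) (x i a)) • f a := by
    ext a
    simp only [Matrix.det_apply', Finset.sum_smul, Finset.sum_apply, Pi.smul_apply, mul_smul,
      Matrix.of_apply]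
  rw [h]
  refine Submodule.sum_mem _ fun σ _ => Submodule.smul_mem _ _ ?_
  have := hprod σ Finset.univ
  rwa [Equiv.sum_comp σ o] at this

lemma exists_prod_tr_smul_mem :
    ∃ s, ∀ L : List (ℕ × ℕ),
      (fun a => (L.map fun p => P.tr (A ⧸ Fr.block I) (a p.1 * a p.2)).prod • Fr.word C.l) ∈
        P.genPolys b ((L.map fun p => ({p.1} + {p.2} : Multiset ℕ)).sum) s := by
  let V := A ⧸ Fr.block I
  let β := Module.finBasis K V
  let φ : Fin (Module.finrank K V) → A →ₗ[K] K :=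
    fun i => β.coord i ∘ₗ (Fr.block I).mkQ.restrictScalars K
  have hφ0 : ∀ i x, φ i x = β.repr (Submodule.Quotient.mk x) i := fun i x => rfl
  have hφ : ∀ i, ∀ x ∈ Fr.block I, φ i x = 0 := by
    intro i x hx
    rw [hφ0, (Submodule.Quotient.mk_eq_zero _).2 hx, map_zero, Finsupp.zero_apply]
  obtain ⟨o, ho⟩ := C.exists_det_smul_mem_polys (b := b) φ hφ
  obtain ⟨o', ho'⟩ := C.exists_polys_le (b := b)
  have htr : ∀ (z : A) (x : Fin (Module.finrank K V) → A),
      ∑ j, (Matrix.of fun i k => φ i (Function.update x j (z * x j) k)).det =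
        P.tr V z * (Matrix.of fun i j => φ i (x j)).det := by
    intro z x
    let T := LinearMap.toMatrix β β (Algebra.lsmul K K V (P.opL z))
    have hT : T.trace = P.tr V z := by
      rw [tr_apply, LinearMap.trace_eq_matrix_trace K β]
    rw [← hT, ← Matrix.sum_det_updateCol_mul]
    refine Finset.sum_congr rfl fun j _ => ?_
    congr 1
    ext i k
    rw [Matrix.of_apply, Matrix.updateCol_apply]
    split_ifs with hk
    · subst hk
      rw [Function.update_self, hφ0]
      exact (congrFun (LinearMap.toMatrix_mulVec_repr β β (Algebra.lsmul K K V (P.opL z))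
        (Submodule.Quotient.mk (x k))) i).symm
    · rw [Function.update_of_ne hk, Matrix.of_apply]
  have key : ∀ (L : List (ℕ × ℕ)) (X : Fin (Module.finrank K V) → Multiset ℕ)
      (s : Fin (Module.finrank K V) → ℕ) (x : Fin (Module.finrank K V) → (ℕ → A) → A),
      (∀ j, x j ∈ P.genPolys b (X j) (s j)) →
      (fun a => ((L.map fun p => P.tr V (a p.1 * a p.2)).prod *
        (Matrix.of fun i j => φ i (x j a)).det) • Fr.word C.l) ∈
        C.polys b ((L.map fun p => ({p.1} + {p.2} : Multiset ℕ)).sum + ∑ j, X j)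
          (∑ j, s j + o) := by
    intro L
    induction L with
    | nil =>
      intro X s x hx
      simpa using ho X s x hx 0 0 _ C.word_mem_polys
    | cons p L ih =>
      intro X s x hx
      have hp : (fun a : ℕ → A => a p.1 * a p.2) ∈ P.genPolys b ({p.1} + {p.2}) 0 := by
        have := P.genPolys_mul (P.var_mem_genPolys (b := b) p.1)
          (P.var_mem_genPolys (b := b) p.2)
        rwa [add_zero] at this
      have h := fun j => ih (Function.update X j ({p.1} + {p.2} + X j)) s
        (Function.update x j fun a => a p.1 * a p.2 * x j a) fun k => by
          by_cases hk : k = j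
          · subst hk
            simp only [Function.update_self]
            have := P.genPolys_mul hp (hx k)
            rwa [zero_add] at this
          · simp only [Function.update_of_ne hk]
            exact hx k
      have hX : ∀ j, ∑ k, Function.update X j ({p.1} + {p.2} + X j) k =
          ({p.1} + {p.2}) + ∑ k, X k := by
        intro j
        rw [Finset.sum_update_of_mem (Finset.mem_univ j), Finset.sdiff_singleton_eq_erase,
          add_assoc, Finset.add_sum_erase _ _ (Finset.mem_univ j)]
      simp only [hX] at h
      have h2 := Submodule.sum_mem _ fun j (_ : j ∈ Finset.univ) => h j
      convert h2 using 1
      · congr 1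
        rw [List.map_cons, List.sum_cons]
        abel
      · ext a
        rw [Finset.sum_apply, ← Finset.sum_smul, ← Finset.mul_sum]
        have h3 := htr (a p.1 * a p.2) fun j => x j a
        have h4 : ∀ j k, Function.update (fun j => x j a) j (a p.1 * a p.2 * x j a) k =
            Function.update x j (fun a => a p.1 * a p.2 * x j a) k a := by
          intro j k
          by_cases hk : k = j
          · subst hk
            simp
          · simp [Function.update_of_ne hk]
        simp only [h4] at h3
        rw [h3, List.map_cons, List.prod_cons]
        congr 1
        ring
  choose c hc using fun j => (Fr.block I).mkQ_surjective (β j)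
  refine ⟨∑ j : Fin (Module.finrank K V), 1 + o + o', fun L => ?_⟩
  have h := key L 0 (fun _ => 1) (fun j _ => c j) fun j => P.const_mem_genPolys (c j)
  have hdet : (Matrix.of fun i j => φ i (c j)) = 1 := by
    ext i j
    rw [Matrix.of_apply, hφ0, ← Submodule.mkQ_apply, hc, β.repr_self, Matrix.one_apply,
      Finsupp.single_apply]
    simp only [eq_comm]
  simp only [hdet, Matrix.det_one, mul_one, Pi.zero_apply, Finset.sum_const_zero, add_zero] at h
  exact ho' _ _ h

end RigidChain

end Frame

end GradingProj

open scoped Matrix in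
lemma Matrix.IsHermitian.trace_sq_le_rank_mul {S : Type*} [Fintype S] [DecidableEq S]
    {M : Matrix S S ℝ} (hM : M.IsHermitian) : M.trace ^ 2 ≤ M.rank * (M * M).trace := by
  have h1 : M.trace = ∑ i, hM.eigenvalues i := by simpa using hM.trace_eq_sum_eigenvalues
  have h2 : (M * M).trace = ∑ i, hM.eigenvalues i ^ 2 := by
    have h := hM.spectral_theorem
    have hsq : M * M = Unitary.conjStarAlgAut ℝ _ hM.eigenvectorUnitary
        (Matrix.diagonal (hM.eigenvalues * hM.eigenvalues)) := by
      conv_lhs => rw [h]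
      rw [← map_mul, Matrix.diagonal_mul_diagonal]
      rfl
    rw [hsq, Unitary.conjStarAlgAut_apply, Matrix.trace_mul_comm, ← mul_assoc,
      Unitary.coe_star_mul_self, one_mul, Matrix.trace_diagonal]
    exact Finset.sum_congr rfl fun i _ => (sq _).symm
  have h3 : M.rank = (Finset.univ.filter fun i => hM.eigenvalues i ≠ 0).card := by
    rw [hM.rank_eq_card_non_zero_eigs, Fintype.card_subtype]
  have h4 : ∑ i ∈ Finset.univ.filter (fun i => hM.eigenvalues i ≠ 0), hM.eigenvalues i =
      ∑ i, hM.eigenvalues i :=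
    Finset.sum_filter_ne_zero _
  have h5 : ∑ i ∈ Finset.univ.filter (fun i => hM.eigenvalues i ≠ 0), hM.eigenvalues i ^ 2 ≤
      ∑ i, hM.eigenvalues i ^ 2 :=
    Finset.sum_le_sum_of_subset_of_nonneg (Finset.subset_univ _) fun i _ _ => sq_nonneg _
  rw [h1, h2, h3, ← h4]
  exact sq_sum_le_card_mul_sum_sq.trans (mul_le_mul_of_nonneg_left h5 (Nat.cast_nonneg _))

lemma sq_sum_sq_le_finrank_span_mul {S T : Type*} [Fintype S] [Fintype T] (v : S → T → ℝ) :
    (∑ s, ∑ t, v s t * v s t) ^ 2 ≤ Module.finrank ℝ (Submodule.span ℝ (Set.range v)) *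
      ∑ s, ∑ s', (∑ t, v s t * v s' t) ^ 2 := by
  classical
  let M : Matrix S T ℝ := Matrix.of v
  have hM : (M * M.transpose).IsHermitian := by
    rw [Matrix.IsHermitian, Matrix.conjTranspose_eq_transpose_of_trivial, Matrix.transpose_mul,
      Matrix.transpose_transpose]
  have h := hM.trace_sq_le_rank_mul
  rw [Matrix.rank_self_mul_transpose, Matrix.rank_eq_finrank_span_row] at h
  refine h.trans_eq ?_
  congr 1
  refine Finset.sum_congr rfl fun s _ => Finset.sum_congr rfl fun s' _ => ?_
  rw [sq]
  congr 1
  exact Finset.sum_congr rfl fun t _ => mul_comm _ _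

lemma sum_card_comp_perm_eq_le (m : ℕ) (E : Type*) [Fintype E] [DecidableEq E] :
    ∑ ρ : Equiv.Perm (Fin m), (Finset.univ.filter fun W : Fin m → E => W ∘ ρ = W).card ≤
      m.factorial * (m + 1) ^ Fintype.card E := by
  classical
  let _ : Fintype (Equiv.Perm (Fin m))ᵈᵐᵃ := Fintype.ofEquiv _ DomMulAct.mk
  have h1 : ∑ ρ : Equiv.Perm (Fin m), (Finset.univ.filter fun W : Fin m → E => W ∘ ρ = W).card =
      ∑ c : (Equiv.Perm (Fin m))ᵈᵐᵃ, Fintype.card (MulAction.fixedBy (Fin m → E) c) := by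
    refine Fintype.sum_equiv DomMulAct.mk _ _ fun ρ => ?_
    rw [← Set.toFinset_card]
    congr 1
    ext W
    simp only [Finset.mem_filter, Finset.mem_univ, true_and, Set.mem_toFinset,
      MulAction.mem_fixedBy]
    rfl
  rw [h1, MulAction.sum_card_fixedBy_eq_card_orbits_mul_card_group, mul_comm]
  have hcard : Fintype.card (Equiv.Perm (Fin m))ᵈᵐᵃ = m.factorial := by
    rw [← Fintype.card_congr (DomMulAct.mk (M := Equiv.Perm (Fin m))), Fintype.card_perm,
      Fintype.card_fin]
  rw [hcard]
  refine Nat.mul_le_mul_left _ ?_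
  have hcount : ∀ (W : Fin m → E) (x : E), Fintype.card {k // W k = x} < m + 1 := fun W x =>
    Nat.lt_succ_of_le ((Fintype.card_subtype_le _).trans_eq (Fintype.card_fin m))
  let content : MulAction.orbitRel.Quotient (Equiv.Perm (Fin m))ᵈᵐᵃ (Fin m → E) →
      E → Fin (m + 1) :=
    fun q x => ⟨_, hcount q.out x⟩
  have hinj : Function.Injective content := by
    intro q q' h
    rw [← q.out_eq', ← q'.out_eq']
    refine Quotient.sound ?_
    have h' : ∀ x, Nonempty ({k // q.out k = x} ≃ {k // q'.out k = x}) := fun x =>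
      ⟨Fintype.equivOfCardEq (congrArg Fin.val (congrFun h x))⟩
    let σ := Equiv.ofFiberEquiv fun x => (h' x).some
    exact ⟨DomMulAct.mk σ, funext fun k => Equiv.ofFiberEquiv_map (fun x => (h' x).some) k⟩
  exact (Fintype.card_le_of_injective _ hinj).trans_eq (by simp)

lemma sum_sq_card_comp_perm_eq_le (m : ℕ) (E : Type*) [Fintype E] [DecidableEq E] :
    ∑ σ : Equiv.Perm (Fin m), ∑ τ : Equiv.Perm (Fin m),
      (Finset.univ.filter fun w : Fin m → E => w ∘ σ = w ∘ τ).card ^ 2 ≤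
      m.factorial ^ 2 * (m + 1) ^ Fintype.card E ^ 2 := by
  have h1 : ∀ σ τ : Equiv.Perm (Fin m),
      (Finset.univ.filter fun w : Fin m → E => w ∘ σ = w ∘ τ).card ^ 2 =
        (Finset.univ.filter fun W : Fin m → E × E => W ∘ σ = W ∘ τ).card := by
    intro σ τ
    rw [sq, ← Finset.card_product]
    refine (Finset.card_equiv (Equiv.arrowProdEquivProdArrow _ _ _) fun W => ?_).symm
    simp [Equiv.arrowProdEquivProdArrow, funext_iff, Prod.ext_iff, forall_and]
  have h2 : ∀ τ : Equiv.Perm (Fin m), ∑ σ : Equiv.Perm (Fin m),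
      (Finset.univ.filter fun W : Fin m → E × E => W ∘ σ = W ∘ τ).card =
      ∑ ρ : Equiv.Perm (Fin m), (Finset.univ.filter fun W : Fin m → E × E => W ∘ ρ = W).card := by
    intro τ
    refine (Fintype.sum_equiv (Equiv.mulRight τ) _ _ fun ρ => ?_).symm
    congr 1
    ext W
    simp only [Finset.mem_filter, Finset.mem_univ, true_and]
    refine ⟨fun h => funext fun k => congrFun h (τ k), fun h => funext fun k => ?_⟩
    simpa using congrFun h (τ.symm k)
  simp only [h1]
  rw [Finset.sum_comm]
  simp only [h2]
  rw [Finset.sum_const, Finset.card_univ, Fintype.card_perm, Fintype.card_fin, smul_eq_mul, sq,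
    mul_assoc]
  refine Nat.mul_le_mul_left _ ((sum_card_comp_perm_eq_le m (E × E)).trans_eq ?_)
  rw [Fintype.card_prod, sq]

/-- The matrix whose rows describe the action of permutations on words of length `m`. -/
def permIndicator (K : Type*) [Zero K] [One K] (m d : ℕ) (σ : Equiv.Perm (Fin m))
    (t : (Fin m → Fin d) × (Fin m → Fin d)) : K :=
  if t.1 = t.2 ∘ σ then 1 else 0

lemma finrank_span_permIndicator (K : Type*) [Field K] [CharZero K] (m d : ℕ) :
    Module.finrank K (Submodule.span K (Set.range (permIndicator K m d))) =
      Module.finrank ℚ (Submodule.span ℚ (Set.range (permIndicator ℚ m d))) := by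
  rw [← finrank_span_algebraMap (K := K) (permIndicator ℚ m d)]
  have h : permIndicator K m d = fun σ => algebraMap ℚ K ∘ permIndicator ℚ m d σ := by
    ext σ t
    simp only [permIndicator, Function.comp_apply, apply_ite (algebraMap ℚ K), map_one, map_zero]
  rw [h]

lemma pow_le_finrank_span_permIndicator_mul (K : Type*) [Field K] [CharZero K] (m d : ℕ) :
    d ^ (2 * m) ≤ Module.finrank K (Submodule.span K (Set.range (permIndicator K m d))) *
      (m + 1) ^ d ^ 2 := by
  rw [finrank_span_permIndicator K, ← finrank_span_permIndicator ℝ]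
  have h := sq_sum_sq_le_finrank_span_mul (permIndicator ℝ m d)
  have hG : ∀ σ τ : Equiv.Perm (Fin m), ∑ t, permIndicator ℝ m d σ t * permIndicator ℝ m d τ t =
      (Finset.univ.filter fun w : Fin m → Fin d => w ∘ σ = w ∘ τ).card := by
    intro σ τ
    rw [Fintype.sum_prod_type_right, Finset.card_filter, Nat.cast_sum]
    refine Finset.sum_congr rfl fun w _ => ?_
    simp [permIndicator, eq_comm]
  have h1 := sum_sq_card_comp_perm_eq_le m (Fin d)
  rw [Fintype.card_fin] at h1
  have h2 : ∑ σ : Equiv.Perm (Fin m), ∑ t, permIndicator ℝ m d σ t * permIndicator ℝ m d σ t =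
      m.factorial * d ^ m := by
    simp [hG, Fintype.card_perm]
  rw [h2] at h
  simp only [hG] at h
  have h3 : (∑ σ : Equiv.Perm (Fin m), ∑ τ : Equiv.Perm (Fin m),
      ((Finset.univ.filter fun w : Fin m → Fin d => w ∘ σ = w ∘ τ).card : ℝ) ^ 2) ≤
      m.factorial ^ 2 * (m + 1) ^ d ^ 2 := by
    exact_mod_cast h1
  have h4 := h.trans (mul_le_mul_of_nonneg_left h3 (Nat.cast_nonneg _))
  have h5 : (0 : ℝ) < (m.factorial : ℝ) ^ 2 := by positivity
  rw [mul_pow, mul_left_comm] at h4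
  have h6 := le_of_mul_le_mul_left h4 h5
  rw [← pow_mul, mul_comm m] at h6
  exact_mod_cast h6

namespace GradingProj

section Positivity

variable {K A G : Type*} [Field K] [Ring A] [Algebra K A] [Group G] (P : GradingProj K A G)

lemma codim_pos [FiniteDimensional K A] [Nontrivial A] (n : ℕ) : 0 < P.codim n := by
  let b := Module.finBasis K A
  have : Nonempty (Fin (Module.finrank K A)) := ⟨⟨0, Module.finrank_pos⟩⟩
  obtain ⟨hfd, hle⟩ := P.finrank_genPolys_le (b := b) n 0
  have h : ∀ k, ∃ f ∈ P.genPolys b (Multiset.range k) 0, f (fun _ => 1) = 1 := by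
    intro k
    induction k with
    | zero => exact ⟨1, P.one_mem_genPolys, rfl⟩
    | succ k ih =>
      obtain ⟨f, hf, hf1⟩ := ih
      have h := P.genPolys_mul (P.var_mem_genPolys k) hf
      rw [Multiset.singleton_add, ← Multiset.range_succ, add_zero] at h
      exact ⟨_, h, by rw [Pi.mul_apply, hf1, mul_one]⟩
  obtain ⟨f, hf, hf1⟩ := h n
  have hne : (⟨f, hf⟩ : P.genPolys b (Multiset.range n) 0) ≠ 0 := by
    intro h0
    have h1 := congrFun (congrArg Subtype.val h0) fun _ => 1
    exact one_ne_zero (hf1.symm.trans h1)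
  have hpos := (Module.finrank_pos_iff_exists_ne_zero (R := K)).2 ⟨_, hne⟩
  simpa using hpos.trans_le hle

end Positivity

namespace Frame

variable {K A G : Type*} [Field K] [Ring A] [Algebra K A] [Group G] {P : GradingProj K A G}
variable {Fr : P.Frame} {I : Finset (Fin Fr.n)}
lemma Linked.nontrivial (hI : Fr.Linked I) : Nontrivial A := by
  obtain ⟨l, -, -, hl⟩ := hI
  exact ⟨_, _, hl⟩

lemma dim_pos [FiniteDimensional K A] (hne : I.Nonempty) : 0 < Fr.dim I := by
  have : Nontrivial (A ⧸ Fr.block I) := by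
    obtain ⟨i, hi⟩ := hne
    refine Submodule.Quotient.nontrivial_iff.2 fun h => ?_
    have h1 : (1 : A) ∈ Fr.block I := h ▸ Submodule.mem_top
    exact Fr.one_notMem i (Fr.mem_block.1 h1 i hi)
  exact Module.finrank_pos

variable [FiniteDimensional K A] [CharZero K]

lemma Linked.exists_pow_le_codim [IsAlgClosed K] (hI : Fr.Linked I) :
    ∃ s, ∀ m s', s ≤ s' → Fr.dim I ^ (2 * m) ≤
      Module.finrank K A ^ s' * P.codim (m + m + s') * (m + 1) ^ Fr.dim I ^ 2 := by
  have := hI.nontrivial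
  let b := Module.finBasis K A
  have : Nonempty (Fin (Module.finrank K A)) := ⟨⟨0, Module.finrank_pos⟩⟩
  obtain ⟨C⟩ := hI.nonempty_rigidChain
  obtain ⟨s, hs⟩ := C.exists_prod_tr_smul_mem (b := b)
  obtain ⟨c, c', hc⟩ := Fr.exists_dual_families I
  obtain ⟨ψ, hψ⟩ := Module.Projective.exists_dual_ne_zero K C.word_ne_zero
  refine ⟨s, fun m s' hs' => ?_⟩
  obtain ⟨hfd, hle⟩ := P.finrank_genPolys_le (b := b) (m + m) s'
  rw [Nat.card_fin] at hle
  refine (pow_le_finrank_span_permIndicator_mul K m (Fr.dim I)).trans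
    (Nat.mul_le_mul_right _ (le_trans ?_ hle))
  let a : (Fin m → Fin (Fr.dim I)) × (Fin m → Fin (Fr.dim I)) → ℕ → A := fun t =>
    extendZero (Fin.append (fun k => c (t.1 k)) fun k => c' (t.2 k))
  have ha1 : ∀ t (k : Fin m), a t k = c (t.1 k) := by
    intro t k
    have := extendZero_val (Fin.append (fun k => c (t.1 k)) fun k => c' (t.2 k)) (Fin.castAdd m k)
    simpa using this
  have ha2 : ∀ t (k : Fin m), a t (m + k) = c' (t.2 k) := by
    intro t k
    have := extendZero_val (Fin.append (fun k => c (t.1 k)) fun k => c' (t.2 k)) (Fin.natAdd m k)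
    rwa [Fin.append_right, Fin.val_natAdd] at this
  let ev : ((ℕ → A) → A) →ₗ[K] ((Fin m → Fin (Fr.dim I)) × (Fin m → Fin (Fr.dim I)) → K) :=
    LinearMap.pi fun t => (ψ (Fr.word C.l))⁻¹ • ψ ∘ₗ LinearMap.proj (a t)
  have hmem : Submodule.span K (Set.range (permIndicator K m (Fr.dim I))) ≤
      (P.genPolys b (Multiset.range (m + m)) s').map ev := by
    rw [Submodule.span_le]
    rintro _ ⟨σ, rfl⟩
    have h := hs ((List.finRange m).map fun k : Fin m => ((k : ℕ), m + (σ k : ℕ)))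
    simp only [List.map_map, Function.comp_def] at h
    have hX : ((List.finRange m).map fun k : Fin m =>
        ({(k : ℕ)} + {m + (σ k : ℕ)} : Multiset ℕ)).sum = Multiset.range (m + m) := by
      rw [← Fin.sum_univ_def, Finset.sum_add_distrib,
        Equiv.sum_comp σ fun k : Fin m => ({m + (k : ℕ)} : Multiset ℕ),
        Fin.sum_univ_eq_sum_range (fun k => ({k} : Multiset ℕ)),
        Fin.sum_univ_eq_sum_range (fun k => ({m + k} : Multiset ℕ)),
        ← Finset.sum_range_add (fun k => ({k} : Multiset ℕ)), Finset.sum_multiset_singleton]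
      rfl
    rw [hX] at h
    refine ⟨_, P.genPolys_mono hs' h, ?_⟩
    ext t
    have hprod : ∀ k : Fin m, P.tr (A ⧸ Fr.block I) (a t k * a t (m + (σ k : ℕ))) =
        if t.1 k = t.2 (σ k) then 1 else 0 := by
      intro k
      rw [ha1, ha2, hc]
    simp only [ev, LinearMap.pi_apply, LinearMap.smul_apply, LinearMap.comp_apply,
      LinearMap.proj_apply, map_smul, smul_eq_mul, hprod]
    rw [mul_left_comm, inv_mul_cancel₀ hψ, mul_one, ← Fin.prod_univ_def,
      Finset.prod_ite_zero, Finset.prod_const_one, permIndicator]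
    simp [funext_iff]
  have : FiniteDimensional K ((P.genPolys b (Multiset.range (m + m)) s').map ev) := inferInstance
  exact (Submodule.finrank_mono hmem).trans (Submodule.finrank_map_le _ _)

lemma Linked.le_codim [IsAlgClosed K] (hI : Fr.Linked I) (hd : 0 < Fr.dim I) :
    ∃ (C : ℝ) (p : ℕ), 0 < C ∧
      ∀ n, 0 < n → C * (Fr.dim I : ℝ) ^ n ≤ (P.codim n : ℝ) * (n : ℝ) ^ p := by
  have := hI.nontrivial
  obtain ⟨s, hs⟩ := hI.exists_pow_le_codim
  set d := Fr.dim I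
  set D := Module.finrank K A
  have hD : 1 ≤ D := Module.finrank_pos
  have key : ∀ n, 0 < n → d ^ n ≤ d ^ (s + 1) * D ^ (s + 1) * 2 ^ d ^ 2 *
      (P.codim n * n ^ d ^ 2) := by
    intro n hn
    by_cases hsn : n < s
    · calc d ^ n ≤ d ^ (s + 1) * 1 * 1 * (1 * 1) := by
            simpa using Nat.pow_le_pow_right hd (by lia)
        _ ≤ _ := by
          gcongr
          · exact Nat.one_le_pow _ _ hD
          · exact Nat.one_le_two_pow
          · exact P.codim_pos n
          · exact Nat.one_le_pow _ _ hn
    · obtain ⟨m, s', h1, h2, rfl⟩ : ∃ m s', s ≤ s' ∧ s' ≤ s + 1 ∧ n = m + m + s' :=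
        ⟨(n - s) / 2, n - 2 * ((n - s) / 2), by lia, by lia, by lia⟩
      calc d ^ (m + m + s') = d ^ s' * d ^ (2 * m) := by ring
        _ ≤ d ^ (s + 1) * (D ^ s' * P.codim (m + m + s') * (m + 1) ^ d ^ 2) :=
          Nat.mul_le_mul (Nat.pow_le_pow_right hd h2) (hs m s' h1)
        _ ≤ d ^ (s + 1) * (D ^ (s + 1) * P.codim (m + m + s') *
            (2 * (m + m + s')) ^ d ^ 2) := by
          gcongr
          lia
        _ = _ := by
          rw [mul_pow]
          ring
  refine ⟨((d ^ (s + 1) * D ^ (s + 1) * 2 ^ d ^ 2 : ℕ) : ℝ)⁻¹, d ^ 2, by positivity,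
    fun n hn => ?_⟩
  rw [inv_mul_le_iff₀ (by positivity)]
  exact_mod_cast key n hn

lemma exists_linked [Nontrivial A] : ∃ I, Fr.Linked I ∧ 0 < Fr.dim I := by
  obtain ⟨i⟩ : Nonempty (Fin Fr.n) := by
    by_contra hn
    rw [not_nonempty_iff] at hn
    exact not_isNilpotent_one (P.isNilpotent_of_mem_rad (Fr.mem_rad 1 fun i => hn.elim i))
  have h : Fr.Linked {i} := ⟨[(i, 1)], by simp, by simp, by
    have h0 : Fr.e i ≠ 0 := fun h0 => Fr.e_notMem i (by rw [h0]; exact (Fr.N i).zero_mem)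
    simpa [word] using h0⟩
  exact ⟨_, h, dim_pos (Finset.singleton_nonempty i)⟩

end Frame

end GradingProj

namespace GradingProj

theorem exists_codim_bounds {K A G : Type*} [Field K] [Ring A] [Algebra K A] [Group G]
    [FiniteDimensional K A] [CharZero K] [IsAlgClosed K] [Nontrivial A] (P : GradingProj K A G) :
    ∃ (C₁ C₂ r₁ r₂ : ℝ) (d : ℕ), 0 < C₁ ∧ 0 < C₂ ∧ 0 < d ∧
      ∀ n : ℕ, 0 < n →
        C₁ * (n : ℝ) ^ r₁ * (d : ℝ) ^ n ≤ (P.codim n : ℝ) ∧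
        (P.codim n : ℝ) ≤ C₂ * (n : ℝ) ^ r₂ * (d : ℝ) ^ n := by
  obtain ⟨Fr⟩ := P.nonempty_frame
  obtain ⟨I₀, hI₀, hpos⟩ := Fr.exists_linked
  obtain ⟨I, hI, hmax⟩ := (Set.toFinite {I | Fr.Linked I}).exists_maximalFor Fr.dim _ ⟨I₀, hI₀⟩
  have hle : ∀ J, Fr.Linked J → Fr.dim J ≤ Fr.dim I := fun J hJ =>
    (le_total (Fr.dim J) (Fr.dim I)).elim id (hmax hJ)
  have hd : 0 < Fr.dim I := hpos.trans_le (hle I₀ hI₀)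
  obtain ⟨C₁, p, hC₁, h1⟩ := hI.le_codim hd
  obtain ⟨C₂, q, hC₂, h2⟩ := Fr.codim_le hd hle
  refine ⟨C₁, C₂, -(p : ℝ), q, Fr.dim I, hC₁, hC₂, hd, fun n hn => ⟨?_, ?_⟩⟩
  · have hn' : (0 : ℝ) < (n : ℝ) ^ p := by positivity
    rw [Real.rpow_neg n.cast_nonneg, Real.rpow_natCast, mul_right_comm,
      mul_inv_le_iff₀ hn']
    exact h1 n hn
  · rw [Real.rpow_natCast]
    exact h2 n hn

end GradingProj

/-- the analog of Amitsur's conjecture for graded codimensions of a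
finite-dimensional non-nilpotent associative algebra over a field of characteristic `0`,
graded by an arbitrary group `G`: `C₁ n^{r₁} d^n ≤ c_n^gr(A) ≤ C₂ n^{r₂} d^n`. -/
theorem stmt13 {F : Type*} [Field F] [CharZero F] {G : Type*} [Group G] [DecidableEq G]
    {A : Type*} [Ring A] [Algebra F A] [FiniteDimensional F A]
    (𝒜 : G → Submodule F A)
    (hmul : ∀ g h : G, ∀ a ∈ 𝒜 g, ∀ b ∈ 𝒜 h, a * b ∈ 𝒜 (g * h))
    (hdecomp : DirectSum.IsInternal 𝒜)
    (hnonnil : ∀ n : ℕ, ∃ a : Fin n → A, (List.ofFn a).prod ≠ 0) :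
    ∃ (C₁ C₂ r₁ r₂ : ℝ) (d : ℕ), 0 < C₁ ∧ 0 < C₂ ∧ 0 < d ∧
      ∀ n : ℕ, 0 < n →
        C₁ * (n : ℝ) ^ r₁ * (d : ℝ) ^ n ≤ (gradedCodim F 𝒜 n : ℝ) ∧
        (gradedCodim F 𝒜 n : ℝ) ≤ C₂ * (n : ℝ) ^ r₂ * (d : ℝ) ^ n := by
  have : Nontrivial A := by
    obtain ⟨a, ha⟩ := hnonnil 0
    exact ⟨_, _, ha⟩
  obtain ⟨C₁, C₂, r₁, r₂, d, h1, h2, hd, h⟩ :=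
    ((GradingProj.ofInternal 𝒜 hmul hdecomp).baseChange (AlgebraicClosure F)).exists_codim_bounds
  refine ⟨C₁, C₂, r₁, r₂, d, h1, h2, hd, fun n hn => ?_⟩
  rw [GradingProj.gradedCodim_eq 𝒜 hmul hdecomp,
    ← (GradingProj.ofInternal 𝒜 hmul hdecomp).codim_baseChange (AlgebraicClosure F)]
  exact h n hn
end
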